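/- Let n ≥ 2 and b = (n+2)/n. Let ψ be a real-valued function on the closed half-space that is C¹ there with Lipschitz gradient, is C² in the open half-space ℝⁿ₊, and satisfies det M_b[ψ](x) = 1 for all x ∈ ℝⁿ₊. Assume the equation is uniformly elliptic for ψ, i.e. there is Ĉ > 0 with Ĉ⁻¹ I ≤ M_b[ψ](x) ≤ Ĉ I for all x ∈ ℝⁿ₊, and that ∂ψ/∂x_n(x',0) = 0 for all x' ∈ ℝ^{n-1}. Then there exist a constant a > 0 and a polynomial q of degree at most 2 in the variables x' = (x₁,…,x_{n-1}) such that ψ(x) = q(x') + a·x_n² for all x in the closed half-space. -/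

import Mathlib

open MeasureTheory
open scoped ENNReal

noncomputable section

/-- Euclidean n-space. -/
abbrev Eu (n : ℕ) := EuclideanSpace ℝ (Fin n)

/-- Partial derivative ∂ψ/∂xᵢ. -/
def pd {n : ℕ} (ψ : Eu n → ℝ) (i : Fin n) (x : Eu n) : ℝ :=
  fderiv ℝ ψ x (EuclideanSpace.single i 1)

/-- Second partial derivative ∂²ψ/∂xᵢ∂xⱼ. -/
def pd2 {n : ℕ} (ψ : Eu n → ℝ) (i j : Fin n) (x : Eu n) : ℝ :=
  pd (pd ψ j) i x


/-- The matrix `M_b[ψ](x)`: Hessian of `ψ`, with the `(n,n)` entry replaced by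
`ψ_{x_n x_n} + b ψ_{x_n}/x_n`.  Here `ln` denotes the last index. -/
def Mb {n : ℕ} (b : ℝ) (ψ : Eu n → ℝ) (ln : Fin n) (x : Eu n) :
    Matrix (Fin n) (Fin n) ℝ :=
  Matrix.of fun i j =>
    if i = ln ∧ j = ln then pd2 ψ ln ln x + b * pd ψ ln x / x ln
    else pd2 ψ i j x

/-- `A ≤ B` for symmetric matrices: `B - A` is positive semidefinite. -/
def matLE {n : ℕ} (A B : Matrix (Fin n) (Fin n) ℝ) : Prop := (B - A).PosSemidef

section Matrices

open Matrix

lemma sq_sqrt_sub_one_le {t : ℝ} (ht : 0 < t) : (√t - 1) ^ 2 ≤ t - 1 - Real.log t := by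
  have h1 : Real.log (√t) ≤ √t - 1 := Real.log_le_sub_one_of_pos (Real.sqrt_pos.2 ht)
  rw [Real.log_sqrt ht.le] at h1
  nlinarith [Real.sq_sqrt ht.le]

lemma exists_orthogonal_diag {n : ℕ} {X : Matrix (Fin n) (Fin n) ℝ} (hX : X.PosDef) :
    ∃ (U : Matrix (Fin n) (Fin n) ℝ) (μ : Fin n → ℝ), U * Uᵀ = 1 ∧ (∀ i, 0 < μ i) ∧
      X = U * diagonal μ * Uᵀ ∧ X.trace = ∑ i, μ i ∧ X.det = ∏ i, μ i := by
  refine ⟨hX.1.eigenvectorUnitary, hX.1.eigenvalues, ?_, hX.eigenvalues_pos, ?_, ?_, ?_⟩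
  · have := Matrix.mem_unitaryGroup_iff.1 hX.1.eigenvectorUnitary.2
    simpa [star_eq_conjTranspose] using this
  · have := hX.1.spectral_theorem
    rw [Unitary.conjStarAlgAut_apply] at this
    simpa [star_eq_conjTranspose] using this
  · simpa using hX.1.trace_eq_sum_eigenvalues
  · simpa using hX.1.det_eq_prod_eigenvalues

lemma sq_quadForm_sub_le_of_det_eq_one {n : ℕ} {X : Matrix (Fin n) (Fin n) ℝ} (hX : X.PosDef)
    (hdet : X.det = 1) (w : Fin n → ℝ) :
    (w ⬝ᵥ X *ᵥ w - w ⬝ᵥ w) ^ 2 ≤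
      (w ⬝ᵥ w) ^ 2 * ((1 + √X.trace) ^ 2 * (X.trace - n)) := by
  obtain ⟨U, μ, hU, hμ, hXe, htr, hd⟩ := exists_orthogonal_diag hX
  set c := Uᵀ *ᵥ w with hc
  have hw : w ⬝ᵥ w = ∑ i, c i ^ 2 := by
    have : c ⬝ᵥ c = w ⬝ᵥ w := by
      rw [hc, dotProduct_mulVec, vecMul_transpose, mulVec_mulVec, hU, one_mulVec]
    rw [← this]; simp [dotProduct, pow_two]
  have hXw : w ⬝ᵥ X *ᵥ w = ∑ i, μ i * c i ^ 2 := by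
    have : w ⬝ᵥ X *ᵥ w = c ⬝ᵥ (diagonal μ *ᵥ c) := by
      rw [hXe, hc, dotProduct_mulVec (Uᵀ *ᵥ w), ← mulVec_mulVec, ← mulVec_mulVec,
        dotProduct_mulVec w U, ← mulVec_transpose U w, dotProduct_mulVec]
    rw [this]; simp only [dotProduct, mulVec_diagonal]
    exact Finset.sum_congr rfl fun i _ => by ring
  have hle : ∀ i, μ i ≤ X.trace := fun i => by
    rw [htr]; exact Finset.single_le_sum (fun j _ => (hμ j).le) (Finset.mem_univ i)
  have hlog : ∑ i, Real.log (μ i) = 0 := by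
    rw [← Real.log_prod (fun i _ => (hμ i).ne'), ← hd, hdet, Real.log_one]
  have hsum : ∑ i, (μ i - 1) ^ 2 ≤ (1 + √X.trace) ^ 2 * (X.trace - n) := by
    have h1 : X.trace - n = ∑ i, (μ i - 1 - Real.log (μ i)) := by
      simp [Finset.sum_sub_distrib, hlog, htr]
    rw [h1, Finset.mul_sum]
    refine Finset.sum_le_sum fun i _ => ?_
    have h2 : (μ i - 1) ^ 2 = (1 + √(μ i)) ^ 2 * (√(μ i) - 1) ^ 2 := by
      have := Real.sq_sqrt (hμ i).le
      rw [← mul_pow]; congr 1; nlinarith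
    rw [h2]
    gcongr
    · exact hle i
    · exact sq_sqrt_sub_one_le (hμ i)
  have hdiff : w ⬝ᵥ X *ᵥ w - w ⬝ᵥ w = ∑ i, (μ i - 1) * c i ^ 2 := by
    rw [hXw, hw, ← Finset.sum_sub_distrib]; exact Finset.sum_congr rfl fun i _ => by ring
  rw [hdiff]
  calc (∑ i, (μ i - 1) * c i ^ 2) ^ 2
      ≤ (∑ i, (μ i - 1) ^ 2) * ∑ i, (c i ^ 2) ^ 2 := Finset.sum_mul_sq_le_sq_mul_sq _ _ _
    _ ≤ ((1 + √X.trace) ^ 2 * (X.trace - n)) * (w ⬝ᵥ w) ^ 2 := by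
        gcongr
        · exact (Finset.sum_nonneg fun i _ => sq_nonneg _).trans hsum
        · rw [hw, pow_two, Finset.sum_mul]
          refine Finset.sum_le_sum fun i _ => ?_
          rw [pow_two]
          gcongr
          exact Finset.single_le_sum (fun j _ => sq_nonneg (c j)) (Finset.mem_univ i)
    _ = _ := by ring

lemma matLE.quadForm_le {n : ℕ} {A B : Matrix (Fin n) (Fin n) ℝ} (h : matLE A B)
    (z : Fin n → ℝ) : z ⬝ᵥ A *ᵥ z ≤ z ⬝ᵥ B *ᵥ z := by
  have := h.dotProduct_mulVec_nonneg z
  simpa [sub_mulVec, dotProduct_sub] using this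

lemma isHermitian_of_matLE {n : ℕ} {A : Matrix (Fin n) (Fin n) ℝ} {c : ℝ}
    (h : matLE (c • (1 : Matrix (Fin n) (Fin n) ℝ)) A) : A.IsHermitian := by
  have h1 : (c • (1 : Matrix (Fin n) (Fin n) ℝ)).IsHermitian := by
    simp [IsHermitian]
  simpa using h.1.add h1

lemma posDef_of_matLE {n : ℕ} {A : Matrix (Fin n) (Fin n) ℝ} {c : ℝ} (hc : 0 < c)
    (h : matLE (c • (1 : Matrix (Fin n) (Fin n) ℝ)) A) : A.PosDef := by
  refine posDef_iff_dotProduct_mulVec.2 ⟨isHermitian_of_matLE h, fun x hx => ?_⟩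
  have h1 := h.quadForm_le x
  have h2 : 0 < x ⬝ᵥ x := by
    have := dotProduct_star_self_pos_iff.2 hx
    simpa using this
  simp only [smul_mulVec, one_mulVec, dotProduct_smul, smul_eq_mul] at h1
  simp only [star_trivial]
  have := mul_pos hc h2
  linarith

/-- Vectors `V k` diagonalising the inverse of `A`, along which the trace of `A⁻¹ (B - A)`
controls the quadratic form of `B - A` for every `B` with the same determinant. -/
lemma exists_frame {n : ℕ} {C : ℝ} (hC : 0 < C) {A : Matrix (Fin n) (Fin n) ℝ}
    (hA1 : matLE (C⁻¹ • (1 : Matrix (Fin n) (Fin n) ℝ)) A)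
    (hA2 : matLE A (C • (1 : Matrix (Fin n) (Fin n) ℝ))) (hdet : A.det = 1) :
    ∃ V : Fin n → Fin n → ℝ,
      (∀ z, C⁻¹ * (z ⬝ᵥ z) ≤ ∑ k, (V k ⬝ᵥ z) ^ 2) ∧
      (∀ z, ∑ k, (V k ⬝ᵥ z) ^ 2 ≤ C * (z ⬝ᵥ z)) ∧
      ∀ B : Matrix (Fin n) (Fin n) ℝ, matLE (C⁻¹ • (1 : Matrix (Fin n) (Fin n) ℝ)) B →
        matLE B (C • (1 : Matrix (Fin n) (Fin n) ℝ)) → B.det = 1 → ∀ z,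
        (z ⬝ᵥ B *ᵥ z - z ⬝ᵥ A *ᵥ z) ^ 2 ≤ (C ^ 2 * (1 + √(n * C ^ 2)) ^ 2) * (z ⬝ᵥ z) ^ 2 *
          ∑ k, (V k ⬝ᵥ B *ᵥ V k - V k ⬝ᵥ A *ᵥ V k) := by
  have hAp := posDef_of_matLE (inv_pos.2 hC) hA1
  obtain ⟨U, μ, hU, hμ, hAe, -, hd⟩ := exists_orthogonal_diag hAp
  have hU' : Uᵀ * U = 1 := mul_eq_one_comm.1 hU
  set M : Matrix (Fin n) (Fin n) ℝ := diagonal (fun i => (√(μ i))⁻¹) * Uᵀ with hM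
  have hMT : Mᵀ = U * diagonal (fun i => (√(μ i))⁻¹) := by
    rw [hM, transpose_mul, transpose_transpose, diagonal_transpose]
  have hs : ∀ i, (√(μ i))⁻¹ * μ i * (√(μ i))⁻¹ = 1 := fun i => by
    have h1 := Real.sqrt_pos.2 (hμ i)
    have h2 := Real.mul_self_sqrt (hμ i).le
    field_simp
    rw [pow_two, h2]
  have hMAM : M * A * Mᵀ = 1 := by
    rw [hMT, hM, hAe]
    have : diagonal (fun i => (√(μ i))⁻¹) * Uᵀ * (U * diagonal μ * Uᵀ) *
        (U * diagonal fun i => (√(μ i))⁻¹) = diagonal (fun i => (√(μ i))⁻¹) * (Uᵀ * U) *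
        diagonal μ * (Uᵀ * U) * diagonal (fun i => (√(μ i))⁻¹) := by
      simp only [Matrix.mul_assoc]
    rw [this, hU']
    simp only [Matrix.mul_one, diagonal_mul_diagonal, hs, diagonal_one]
  have hAMM : A * (Mᵀ * M) = 1 := by
    have h1 : M * (A * Mᵀ) = 1 := by rw [← Matrix.mul_assoc, hMAM]
    have h2 := mul_eq_one_comm.1 h1
    rw [← Matrix.mul_assoc, h2]
  have hMMA : Mᵀ * M * A = 1 := mul_eq_one_comm.1 hAMM
  have hsumsq : ∀ z, ∑ k, (M k ⬝ᵥ z) ^ 2 = z ⬝ᵥ (Mᵀ * M) *ᵥ z := fun z => by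
    rw [← mulVec_mulVec, dotProduct_mulVec, vecMul_transpose]
    simp [dotProduct, mulVec, pow_two]
  have hdiag : ∀ B : Matrix (Fin n) (Fin n) ℝ, ∀ k, (M * B * Mᵀ) k k = M k ⬝ᵥ B *ᵥ M k := by
    intro B k
    have h1 : (M * B * Mᵀ) k k = (M * B) k ⬝ᵥ M k := by
      rw [mul_apply]; rfl
    have h2 : (M * B) k = M k ᵥ* B := mul_apply_eq_vecMul _ _ _
    rw [h1, h2, dotProduct_mulVec]
  have hzA : ∀ z, A *ᵥ ((Mᵀ * M) *ᵥ z) = z := fun z => by rw [mulVec_mulVec, hAMM, one_mulVec]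
  have hAu : ∀ z, z ⬝ᵥ A *ᵥ z ≤ C * (z ⬝ᵥ z) := fun z => by
    have := hA2.quadForm_le z
    simpa only [smul_mulVec, one_mulVec, dotProduct_smul, smul_eq_mul] using this
  have hAl : ∀ z, C⁻¹ * (z ⬝ᵥ z) ≤ z ⬝ᵥ A *ᵥ z := fun z => by
    have := hA1.quadForm_le z
    simpa only [smul_mulVec, one_mulVec, dotProduct_smul, smul_eq_mul] using this
  have hAt : Aᵀ = A := by simpa using (isHermitian_of_matLE hA1).eq
  have hAsymm : ∀ u v, u ⬝ᵥ A *ᵥ v = A *ᵥ u ⬝ᵥ v := fun u v => by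
    rw [dotProduct_mulVec, ← mulVec_transpose, hAt]
  have hupper : ∀ z, ∑ k, (M k ⬝ᵥ z) ^ 2 ≤ C * (z ⬝ᵥ z) := fun z => by
    rw [hsumsq]
    set y := (Mᵀ * M) *ᵥ z with hy
    have hz : A *ᵥ y = z := hzA z
    have h1 := hAl y
    rw [hz, dotProduct_comm] at h1
    have h2 : 0 ≤ (C • z - y) ⬝ᵥ (C • z - y) := by
      simpa using dotProduct_star_self_nonneg (C • z - y)
    simp only [sub_dotProduct, dotProduct_sub, smul_dotProduct, dotProduct_smul, smul_eq_mul,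
      dotProduct_comm y z] at h1 h2
    have h3 : y ⬝ᵥ y ≤ C * (z ⬝ᵥ y) := by
      rwa [inv_mul_le_iff₀ hC] at h1
    have h4 : 0 ≤ C * (C * (z ⬝ᵥ z) - z ⬝ᵥ y) := by nlinarith
    have := nonneg_of_mul_nonneg_right h4 hC
    linarith
  refine ⟨M, fun z => ?_, hupper, fun B hB1 hB2 hBd z => ?_⟩
  · rw [hsumsq]
    set y := (Mᵀ * M) *ᵥ z with hy
    have hz : A *ᵥ y = z := hzA z
    have h1 : 0 ≤ (y - C⁻¹ • z) ⬝ᵥ A *ᵥ (y - C⁻¹ • z) := by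
      simpa using hAp.posSemidef.dotProduct_mulVec_nonneg (y - C⁻¹ • z)
    have h2 := hAu z
    simp only [mulVec_sub, mulVec_smul, sub_dotProduct, dotProduct_sub, smul_dotProduct,
      dotProduct_smul, smul_eq_mul, hz, dotProduct_comm y z] at h1
    rw [hAsymm y z, hz] at h1
    have h3 : C⁻¹ * (C⁻¹ * (z ⬝ᵥ A *ᵥ z)) ≤ C⁻¹ * (z ⬝ᵥ z) := by
      refine mul_le_mul_of_nonneg_left ?_ (inv_pos.2 hC).le
      rwa [inv_mul_le_iff₀ hC]
    linarith
  · have hBp := posDef_of_matLE (inv_pos.2 hC) hB1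
    have hMdet : M.det * Mᵀ.det = 1 := by
      have := congrArg det hMAM
      rw [det_mul, det_mul, hdet, det_one] at this
      linarith
    have hXp : (M * B * Mᵀ).PosDef := by
      have h0 : M.det ≠ 0 := left_ne_zero_of_mul_eq_one hMdet
      have := hBp.mul_mul_conjTranspose_same (B := M)
        (vecMul_injective_of_isUnit ((isUnit_iff_isUnit_det _).2 (isUnit_iff_ne_zero.2 h0)))
      simpa using this
    have hXd : (M * B * Mᵀ).det = 1 := by
      rw [det_mul, det_mul, hBd]; linarith
    have htr : ∀ Y : Matrix (Fin n) (Fin n) ℝ, (M * Y * Mᵀ).trace = ∑ k, M k ⬝ᵥ Y *ᵥ M k :=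
      fun Y => Finset.sum_congr rfl fun k _ => hdiag Y k
    have hsub : ∑ k, (M k ⬝ᵥ B *ᵥ M k - M k ⬝ᵥ A *ᵥ M k) = (M * B * Mᵀ).trace - n := by
      rw [Finset.sum_sub_distrib, ← htr, ← htr, hMAM]; simp
    have htrle : (M * B * Mᵀ).trace ≤ n * C ^ 2 := by
      rw [htr]
      have h1 : ∀ k, M k ⬝ᵥ B *ᵥ M k ≤ C * ∑ i, (M k ⬝ᵥ Pi.single i 1) ^ 2 := fun k => by
        have := hB2.quadForm_le (M k)
        simp only [smul_mulVec, one_mulVec, dotProduct_smul, smul_eq_mul] at this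
        simp only [dotProduct_single, mul_one, pow_two]
        exact this
      calc ∑ k, M k ⬝ᵥ B *ᵥ M k ≤ ∑ k, C * ∑ i, (M k ⬝ᵥ Pi.single i 1) ^ 2 :=
            Finset.sum_le_sum fun k _ => h1 k
        _ = C * ∑ i, ∑ k, (M k ⬝ᵥ Pi.single i 1) ^ 2 := by
            rw [← Finset.mul_sum, Finset.sum_comm]
        _ ≤ C * ∑ i : Fin n, C := by
            gcongr with i
            simpa using hupper (Pi.single i 1)
        _ = n * C ^ 2 := by simp; ring
    have hMz : Mᵀ *ᵥ (M *ᵥ (A *ᵥ z)) = z := by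
      rw [mulVec_mulVec, mulVec_mulVec, hMMA, one_mulVec]
    set w := M *ᵥ (A *ᵥ z) with hw
    have hww : w ⬝ᵥ w = z ⬝ᵥ A *ᵥ z := by
      nth_rewrite 1 [hw]
      rw [dotProduct_comm, dotProduct_mulVec, ← mulVec_transpose, hMz]
    have hwXw : w ⬝ᵥ (M * B * Mᵀ) *ᵥ w = z ⬝ᵥ B *ᵥ z := by
      rw [← mulVec_mulVec, hMz, ← mulVec_mulVec, dotProduct_mulVec, ← mulVec_transpose, hMz]
    have key := sq_quadForm_sub_le_of_det_eq_one hXp hXd w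
    rw [hwXw, hww] at key
    have hnn : 0 ≤ (M * B * Mᵀ).trace - n := by
      by_contra hneg
      obtain ⟨U, μ, -, hμ, -, htr', hd'⟩ := exists_orthogonal_diag hXp
      have hlog : ∑ i, Real.log (μ i) = 0 := by
        rw [← Real.log_prod (fun i _ => (hμ i).ne'), ← hd', hXd, Real.log_one]
      have : (M * B * Mᵀ).trace - n = ∑ i, (μ i - 1 - Real.log (μ i)) := by
        simp [Finset.sum_sub_distrib, hlog, htr']
      exact hneg (this ▸ Finset.sum_nonneg fun i _ =>
        (sq_nonneg _).trans (sq_sqrt_sub_one_le (hμ i)))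
    rw [hsub]
    have hzz : 0 ≤ z ⬝ᵥ A *ᵥ z := by simpa using hAp.posSemidef.dotProduct_mulVec_nonneg z
    calc _ ≤ (z ⬝ᵥ A *ᵥ z) ^ 2 * ((1 + √(M * B * Mᵀ).trace) ^ 2 * ((M * B * Mᵀ).trace - n)) := key
      _ ≤ (C * (z ⬝ᵥ z)) ^ 2 * ((1 + √(n * C ^ 2)) ^ 2 * ((M * B * Mᵀ).trace - n)) := by
          gcongr
          exact hAu z
      _ = _ := by ring

end Matrices

section SecondDifferences

open Filter Topology Set

variable {E : Type*} [NormedAddCommGroup E] [NormedSpace ℝ E]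

/-- The symmetric second difference of `u` at `x` with step `h`. -/
def secondDiff (u : E → ℝ) (h x : E) : ℝ := u (x + h) + u (x - h) - 2 * u x

/-- The Hessian quadratic form of `u` at `x`. -/
def hessQuad (u : E → ℝ) (x v : E) : ℝ := fderiv ℝ (fderiv ℝ u) x v v

lemma hessQuad_smul (u : E → ℝ) (x : E) (c : ℝ) (v : E) :
    hessQuad u x (c • v) = c ^ 2 * hessQuad u x v := by
  simp [hessQuad, pow_two, mul_assoc]

lemma tendsto_symm_second_quotient {φ φ' : ℝ → ℝ} {c : ℝ}
    (h1 : ∀ᶠ s in 𝓝 (0 : ℝ), HasDerivAt φ (φ' s) s) (h2 : HasDerivAt φ' c 0) :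
    Tendsto (fun s => (φ s + φ (-s) - 2 * φ 0) / s ^ 2) (𝓝[>] 0) (𝓝 c) := by
  have hneg : Tendsto (fun s : ℝ => -s) (𝓝 0) (𝓝 0) := by
    simpa using (continuous_neg.tendsto (0 : ℝ))
  have hφ0 : ContinuousAt φ 0 := h1.self_of_nhds.continuousAt
  refine HasDerivAt.lhopital_zero_nhdsGT (f' := fun s => φ' s - φ' (-s)) (g' := fun s => 2 * s)
    ?_ ?_ ?_ ?_ ?_ ?_
  · refine nhdsWithin_le_nhds ?_
    filter_upwards [h1, hneg.eventually h1] with s hs hs'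
    have := (hs.add (hs'.comp s (hasDerivAt_neg s))).sub_const (2 * φ 0)
    simpa [sub_eq_add_neg, Function.comp_def] using this
  · refine Eventually.of_forall fun s => ?_
    simpa using hasDerivAt_pow 2 s
  · filter_upwards [self_mem_nhdsWithin] with s hs
    have : (0 : ℝ) < s := hs
    positivity
  · refine Tendsto.mono_left ?_ nhdsWithin_le_nhds
    have h3 : Tendsto (fun s => φ (-s)) (𝓝 0) (𝓝 (φ 0)) := hφ0.tendsto.comp hneg
    have := (hφ0.tendsto.add h3).sub_const (2 * φ 0)
    convert this using 2
    ring
  · refine Tendsto.mono_left ?_ nhdsWithin_le_nhds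
    have : Continuous fun s : ℝ => s ^ 2 := by fun_prop
    simpa using this.tendsto 0
  · have h3 := (h2.tendsto_slope_zero).mono_left (nhdsWithin_mono 0 fun s (hs : 0 < s) => hs.ne')
    have h4 : HasDerivAt (fun s => -φ' (-s)) c 0 := by
      have h5 : HasDerivAt φ' c (-0) := by simpa using h2
      simpa [Function.comp_def] using (h5.comp (0 : ℝ) (hasDerivAt_neg 0)).fun_neg
    have h5 := (h4.tendsto_slope_zero).mono_left (nhdsWithin_mono 0 fun s (hs : 0 < s) => hs.ne')
    have h6 := (h3.add h5).div_const 2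
    have : (c + c) / 2 = c := by ring
    rw [this] at h6
    refine h6.congr' ?_
    filter_upwards [self_mem_nhdsWithin] with s hs
    have : (0 : ℝ) < s := hs
    simp
    field_simp
    ring

lemma hasDerivAt_line (x v : E) (s : ℝ) : HasDerivAt (fun s : ℝ => x + s • v) v s := by
  simpa using ((hasDerivAt_id s).smul_const v).const_add x

lemma eventually_hasDerivAt_comp_line {u : E → ℝ} {x : E} (hu : ContDiffAt ℝ 2 u x) (v : E) :
    ∀ᶠ s in 𝓝 (0 : ℝ), HasDerivAt (fun s : ℝ => u (x + s • v)) (fderiv ℝ u (x + s • v) v) s := by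
  have h1 : ∀ᶠ y in 𝓝 x, ContDiffAt ℝ 2 u y := hu.eventually (by simp)
  have h2 : Tendsto (fun s : ℝ => x + s • v) (𝓝 0) (𝓝 x) := by
    have : Continuous fun s : ℝ => x + s • v := by fun_prop
    simpa using this.tendsto 0
  filter_upwards [h2.eventually h1] with s hs
  exact (hs.differentiableAt (by simp)).hasFDerivAt.comp_hasDerivAt s (hasDerivAt_line x v s)

lemma hasDerivAt_fderiv_comp_line {u : E → ℝ} {x : E} {v : E} {s : ℝ}
    (hu : ContDiffAt ℝ 2 u (x + s • v)) :
    HasDerivAt (fun s : ℝ => fderiv ℝ u (x + s • v) v) (hessQuad u (x + s • v) v) s := by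
  have h1 : DifferentiableAt ℝ (fderiv ℝ u) (x + s • v) :=
    (hu.fderiv_right (m := 1) (by norm_num)).differentiableAt (by simp)
  have h2 : HasDerivAt (fun s : ℝ => fderiv ℝ u (x + s • v))
      (fderiv ℝ (fderiv ℝ u) (x + s • v) v) s :=
    h1.hasFDerivAt.comp_hasDerivAt s (hasDerivAt_line x v s)
  have h3 := h2.clm_apply (hasDerivAt_const s v)
  simpa [hessQuad] using h3

lemma tendsto_secondDiff {u : E → ℝ} {x : E} (hu : ContDiffAt ℝ 2 u x) (v : E) :
    Tendsto (fun s : ℝ => secondDiff u (s • v) x / s ^ 2) (𝓝[>] 0) (𝓝 (hessQuad u x v)) := by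
  have h2 : HasDerivAt (fun s : ℝ => fderiv ℝ u (x + s • v) v) (hessQuad u x v) 0 := by
    simpa using hasDerivAt_fderiv_comp_line (u := u) (x := x) (v := v) (s := 0) (by simpa using hu)
  have := tendsto_symm_second_quotient (eventually_hasDerivAt_comp_line hu v) h2
  simpa [secondDiff, sub_eq_add_neg] using this

lemma IsLocalMax.secondDiff_limit_nonpos {Φ : E → ℝ} {y v : E} {l : ℝ} (hy : IsLocalMax Φ y)
    (hl : Tendsto (fun s : ℝ => secondDiff Φ (s • v) y / s ^ 2) (𝓝[>] 0) (𝓝 l)) : l ≤ 0 := by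
  refine le_of_tendsto hl (nhdsWithin_le_nhds ?_)
  have h1 : Tendsto (fun s : ℝ => y + s • v) (𝓝 0) (𝓝 y) := by
    have : Continuous fun s : ℝ => y + s • v := by fun_prop
    simpa using this.tendsto 0
  have h2 : Tendsto (fun s : ℝ => y - s • v) (𝓝 0) (𝓝 y) := by
    have : Continuous fun s : ℝ => y - s • v := by fun_prop
    simpa using this.tendsto 0
  filter_upwards [h1.eventually hy, h2.eventually hy] with s hs hs'
  refine div_nonpos_of_nonpos_of_nonneg ?_ (sq_nonneg s)
  unfold secondDiff
  linarith

lemma exists_secondDiff_eq {u : E → ℝ} (hu : ContDiff ℝ 2 u) (x h : E) :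
    ∃ ξ ∈ Ioo (0 : ℝ) 1,
      secondDiff u h x = (hessQuad u (x + ξ • h) h + hessQuad u (x - ξ • h) h) / 2 := by
  have hd : ∀ s : ℝ, HasDerivAt (fun s : ℝ => u (x + s • h)) (fderiv ℝ u (x + s • h) h) s :=
    fun s => (hu.differentiable (by simp) _).hasFDerivAt.comp_hasDerivAt s (hasDerivAt_line x h s)
  have hd2 : ∀ s : ℝ, HasDerivAt (fun s : ℝ => fderiv ℝ u (x + s • h) h)
      (hessQuad u (x + s • h) h) s := fun s => hasDerivAt_fderiv_comp_line hu.contDiffAt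
  set φ : ℝ → ℝ := fun s => u (x + s • h) + u (x + (-s) • h) with hφ
  set φ' : ℝ → ℝ := fun s => fderiv ℝ u (x + s • h) h - fderiv ℝ u (x + (-s) • h) h with hφ'
  set φ'' : ℝ → ℝ := fun s => hessQuad u (x + s • h) h + hessQuad u (x + (-s) • h) h with hφ''
  have h1 : ∀ s, HasDerivAt φ (φ' s) s := fun s => by
    have := (hd s).fun_add ((hd (-s)).comp s (hasDerivAt_neg s))
    simpa [hφ, hφ', Function.comp_def, sub_eq_add_neg] using this
  have h2 : ∀ s, HasDerivAt φ' (φ'' s) s := fun s => by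
    have := (hd2 s).fun_sub ((hd2 (-s)).comp s (hasDerivAt_neg s))
    simpa [hφ', hφ'', Function.comp_def, sub_eq_add_neg] using this
  have hsq : ∀ s : ℝ, HasDerivAt (fun s : ℝ => s ^ 2) (2 * s) s := fun s => by
    simpa using hasDerivAt_pow 2 s
  obtain ⟨a, ha, hae⟩ := exists_ratio_hasDerivAt_eq_ratio_slope φ φ' zero_lt_one
    (fun s _ => (h1 s).continuousAt.continuousWithinAt) (fun s _ => h1 s) (fun s : ℝ => s ^ 2)
    (fun s => 2 * s) (by fun_prop) (fun s _ => hsq s)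
  obtain ⟨ξ, hξ, hξe⟩ := exists_hasDerivAt_eq_slope φ' φ'' ha.1
    (fun s _ => (h2 s).continuousAt.continuousWithinAt) (fun s _ => h2 s)
  refine ⟨ξ, ⟨hξ.1, hξ.2.trans ha.2⟩, ?_⟩
  have h0 : φ' 0 = 0 := by simp [hφ']
  have ha0 : a ≠ 0 := ha.1.ne'
  rw [h0] at hξe
  have h3 : φ' a = a * φ'' ξ := by rw [hξe]; field_simp; ring
  have h4 : φ 1 - φ 0 = secondDiff u h x := by
    simp [hφ, secondDiff, sub_eq_add_neg]; ring
  rw [h4, h3] at hae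
  have h5 : φ'' ξ = hessQuad u (x + ξ • h) h + hessQuad u (x - ξ • h) h := by
    simp [hφ'', sub_eq_add_neg]
  rw [← h5]
  have : a * (secondDiff u h x * 2 - φ'' ξ) = 0 := by linear_combination -hae
  rcases mul_eq_zero.1 this with h | h
  · exact absurd h ha0
  · linarith

lemma continuous_hessQuad {u : E → ℝ} (hu : ContDiff ℝ 2 u) (v : E) :
    Continuous fun x => hessQuad u x v := by
  have h1 : Continuous (fderiv ℝ (fderiv ℝ u)) :=
    (hu.fderiv_right (m := 1) (by norm_num)).continuous_fderiv (by simp)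
  exact (h1.clm_apply continuous_const).clm_apply continuous_const

end SecondDifferences

section Liouville

open Filter Topology Set Metric

/-- A convex function with bounded Hessian such that, at each point, the second derivatives along
a suitable nondegenerate frame control the whole variation of the Hessian. -/
structure HessianControl {n : ℕ} (u : Eu n → ℝ) (lam Lam K : ℝ) : Prop where
  contDiff : ContDiff ℝ 2 u
  nonneg : ∀ x v, 0 ≤ hessQuad u x v
  le : ∀ x v, hessQuad u x v ≤ Lam * ‖v‖ ^ 2
  frame : ∀ x, ∃ V : Fin n → Eu n, (∀ z, lam * ‖z‖ ^ 2 ≤ ∑ k, inner ℝ (V k) z ^ 2) ∧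
    (∀ z, ∑ k, inner ℝ (V k) z ^ 2 ≤ Lam * ‖z‖ ^ 2) ∧
    ∀ y z, (hessQuad u y z - hessQuad u x z) ^ 2 ≤
      K * ‖z‖ ^ 4 * ∑ k, (hessQuad u y (V k) - hessQuad u x (V k))

lemma frame_norm_sq_le {n : ℕ} {Lam : ℝ} {V : Fin n → Eu n}
    (hV : ∀ z, ∑ k, inner ℝ (V k) z ^ 2 ≤ Lam * ‖z‖ ^ 2) (k : Fin n) : ‖V k‖ ^ 2 ≤ Lam := by
  have h1 := (Finset.single_le_sum (fun j _ => sq_nonneg (inner ℝ (V j) (V k)))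
    (Finset.mem_univ k)).trans (hV (V k))
  simp only [real_inner_self_eq_norm_sq] at h1
  by_contra! h
  rcases eq_or_ne (V k) 0 with h0 | h0
  · have h2 := hV (EuclideanSpace.single k 1)
    have h3 : 0 ≤ ∑ k_1, inner ℝ (V k_1) (EuclideanSpace.single k (1 : ℝ)) ^ 2 :=
      Finset.sum_nonneg fun _ _ => sq_nonneg _
    simp [h0] at h h2 h3
    linarith
  · have : 0 < ‖V k‖ ^ 2 := by positivity
    nlinarith

lemma frame_sum_norm_sq_le {n : ℕ} {Lam : ℝ} {V : Fin n → Eu n}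
    (hV : ∀ z, ∑ k, inner ℝ (V k) z ^ 2 ≤ Lam * ‖z‖ ^ 2) : ∑ k, ‖V k‖ ^ 2 ≤ n * Lam := by
  calc ∑ k, ‖V k‖ ^ 2 ≤ ∑ _k : Fin n, Lam := Finset.sum_le_sum fun k _ => frame_norm_sq_le hV k
    _ = n * Lam := by simp

section General

variable {E : Type*} [NormedAddCommGroup E]

lemma secondDiff_comm (u : E → ℝ) (h k x : E) :
    secondDiff (secondDiff u h) k x =
      secondDiff u k (x + h) + secondDiff u k (x - h) - 2 * secondDiff u k x := by
  have e1 : x + k + h = x + h + k := by abel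
  have e2 : x + k - h = x - h + k := by abel
  have e3 : x - k + h = x + h - k := by abel
  have e4 : x - k - h = x - h - k := by abel
  simp only [secondDiff, e1, e2, e3, e4]
  ring

lemma continuous_secondDiff {u : E → ℝ} (hu : Continuous u) (h : E) :
    Continuous (secondDiff u h) := by
  unfold secondDiff; fun_prop

lemma continuous_secondDiff_step {u : E → ℝ} (hu : Continuous u) (x : E) :
    Continuous fun h => secondDiff u h x := by
  unfold secondDiff; fun_prop

variable [NormedSpace ℝ E]

lemma tendsto_secondDiff_secondDiff {u : E → ℝ} (hu : ContDiff ℝ 2 u) (h y V : E) :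
    Tendsto (fun s : ℝ => secondDiff (secondDiff u h) (s • V) y / s ^ 2) (𝓝[>] 0)
      (𝓝 (hessQuad u (y + h) V + hessQuad u (y - h) V - 2 * hessQuad u y V)) := by
  have h1 := ((tendsto_secondDiff (x := y + h) hu.contDiffAt V).add
    (tendsto_secondDiff (x := y - h) hu.contDiffAt V)).sub
    ((tendsto_secondDiff (x := y) hu.contDiffAt V).const_mul 2)
  refine h1.congr fun s => ?_
  rw [secondDiff_comm]
  ring

lemma exists_uniform_secondDiff [ProperSpace E] {u : E → ℝ} (hu : ContDiff ℝ 2 u) (z0 v : E)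
    (t : ℝ) {ε δ : ℝ} (hε : 0 < ε) (hδ : 0 < δ) :
    ∃ s, 0 < s ∧ s < δ ∧ ∀ x ∈ closedBall z0 t,
      |secondDiff u (s • v) x / s ^ 2 - hessQuad u x v| ≤ ε := by
  have huc := (isCompact_closedBall z0 (t + 1)).uniformContinuousOn_of_continuous
    (continuous_hessQuad hu v).continuousOn
  obtain ⟨d, hd, hd'⟩ := Metric.uniformContinuousOn_iff_le.1 huc ε hε
  set c := min d 1 with hc
  have hc0 : 0 < c := lt_min hd one_pos
  set s := min (c / (‖v‖ + 1)) (δ / 2) with hs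
  have hs0 : 0 < s := lt_min (by positivity) (by positivity)
  have hsv : s * ‖v‖ ≤ c := by
    have h1 : s ≤ c / (‖v‖ + 1) := min_le_left _ _
    rw [le_div_iff₀ (by positivity)] at h1
    nlinarith
  refine ⟨s, hs0, (min_le_right _ _).trans_lt (by linarith), fun x hx => ?_⟩
  obtain ⟨ξ, hξ, hξe⟩ := exists_secondDiff_eq hu x (s • v)
  simp only [hessQuad_smul] at hξe
  have hnorm : ‖ξ • s • v‖ ≤ c := by
    rw [norm_smul, norm_smul, Real.norm_of_nonneg hξ.1.le, Real.norm_of_nonneg hs0.le]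
    have : 0 ≤ s * ‖v‖ := by positivity
    nlinarith [hξ.1, hξ.2]
  have hx' : x ∈ closedBall z0 (t + 1) := closedBall_subset_closedBall (by linarith) hx
  have hmem : ∀ w : E, ‖w‖ ≤ c → x + w ∈ closedBall z0 (t + 1) ∧
      |hessQuad u (x + w) v - hessQuad u x v| ≤ ε := fun w hw => by
    have h1 : x + w ∈ closedBall z0 (t + 1) := by
      rw [mem_closedBall] at hx ⊢
      calc dist (x + w) z0 ≤ dist (x + w) x + dist x z0 := dist_triangle _ _ _
        _ ≤ 1 + t := by
            gcongr
            simpa using hw.trans (min_le_right _ _)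
        _ = t + 1 := by ring
    refine ⟨h1, ?_⟩
    have := hd' _ h1 _ hx' (by simpa using hw.trans (min_le_left _ _))
    rwa [Real.dist_eq] at this
  have h1 := (hmem _ hnorm).2
  have h2 := (hmem (-(ξ • s • v)) (by rwa [norm_neg])).2
  rw [← sub_eq_add_neg] at h2
  have h3 : secondDiff u (s • v) x / s ^ 2 =
      (hessQuad u (x + ξ • s • v) v + hessQuad u (x - ξ • s • v) v) / 2 := by
    rw [hξe]; field_simp
  rw [h3]
  rw [abs_le] at h1 h2 ⊢
  constructor <;> linarith

end General

namespace HessianControl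

variable {n : ℕ} {u : Eu n → ℝ} {lam Lam K : ℝ}

lemma continuous (H : HessianControl u lam Lam K) : Continuous u := H.contDiff.continuous

lemma secondDiff_nonneg (H : HessianControl u lam Lam K) (h x : Eu n) : 0 ≤ secondDiff u h x := by
  obtain ⟨ξ, -, h1⟩ := exists_secondDiff_eq H.contDiff x h
  rw [h1]
  have h2 := H.nonneg (x + ξ • h) h
  have h3 := H.nonneg (x - ξ • h) h
  positivity

lemma secondDiff_le (H : HessianControl u lam Lam K) (h x : Eu n) :
    secondDiff u h x ≤ Lam * ‖h‖ ^ 2 := by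
  obtain ⟨ξ, -, h1⟩ := exists_secondDiff_eq H.contDiff x h
  rw [h1]
  have h2 := H.le (x + ξ • h) h
  have h3 := H.le (x - ξ • h) h
  linarith

lemma secondDiff_smul_div_le (H : HessianControl u lam Lam K) (v x : Eu n) {s : ℝ} (hs : 0 < s) :
    secondDiff u (s • v) x / s ^ 2 ≤ Lam * ‖v‖ ^ 2 := by
  rw [div_le_iff₀ (by positivity)]
  refine (H.secondDiff_le _ _).trans (le_of_eq ?_)
  rw [norm_smul, Real.norm_of_nonneg hs.le]
  ring

lemma norm_secondDiff_le (H : HessianControl u lam Lam K) (hLam : 0 ≤ Lam) {r : ℝ} {h : Eu n}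
    (hh : h ∈ ball (0 : Eu n) r) (x : Eu n) : ‖secondDiff u h x‖ ≤ Lam * r ^ 2 := by
  rw [Real.norm_of_nonneg (H.secondDiff_nonneg h x)]
  refine (H.secondDiff_le h x).trans ?_
  have : ‖h‖ < r := by simpa using hh
  gcongr

lemma integrableOn_secondDiff (H : HessianControl u lam Lam K) (r : ℝ) (x : Eu n) :
    IntegrableOn (fun h => secondDiff u h x) (ball 0 r) :=
  ((continuous_secondDiff_step H.continuous x).continuousOn.integrableOn_compact
    (isCompact_closedBall (0 : Eu n) r)).mono_set ball_subset_closedBall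

/-- The integral of second differences over steps in a ball. -/
def ballSecondDiff (u : Eu n → ℝ) (r : ℝ) (x : Eu n) : ℝ :=
  ∫ h in ball (0 : Eu n) r, secondDiff u h x

lemma continuous_ballSecondDiff (H : HessianControl u lam Lam K) (hLam : 0 ≤ Lam) (r : ℝ) :
    Continuous (ballSecondDiff u r) := by
  refine continuous_of_dominated (bound := fun _ => Lam * r ^ 2) ?_ ?_ ?_ ?_
  · exact fun x => (continuous_secondDiff_step H.continuous x).aestronglyMeasurable
  · refine fun x => (ae_restrict_iff' measurableSet_ball).2 (Eventually.of_forall fun h hh => ?_)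
    exact H.norm_secondDiff_le hLam hh x
  · exact integrableOn_const measure_ball_lt_top.ne
  · exact Eventually.of_forall fun h => continuous_secondDiff H.continuous h

lemma ballSecondDiff_nonneg (H : HessianControl u lam Lam K) (r : ℝ) (x : Eu n) :
    0 ≤ ballSecondDiff u r x :=
  integral_nonneg fun h => H.secondDiff_nonneg h x

lemma ballSecondDiff_le (H : HessianControl u lam Lam K) (hLam : 0 ≤ Lam) (r : ℝ) (x : Eu n) :
    ballSecondDiff u r x ≤ Lam * r ^ 2 * volume.real (ball (0 : Eu n) r) := by
  have := norm_setIntegral_le_of_norm_le_const (μ := volume) (f := fun h => secondDiff u h x)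
    (measure_ball_lt_top (x := (0 : Eu n)) (r := r)) fun h hh => H.norm_secondDiff_le hLam hh x
  exact (le_abs_self _).trans this

lemma tendsto_secondDiff_ballSecondDiff (H : HessianControl u lam Lam K) (r : ℝ)
    (y V : Eu n) :
    Tendsto (fun s : ℝ => secondDiff (ballSecondDiff u r) (s • V) y / s ^ 2) (𝓝[>] 0)
      (𝓝 (∫ h in ball (0 : Eu n) r,
        (hessQuad u (y + h) V + hessQuad u (y - h) V - 2 * hessQuad u y V))) := by
  have hcongr : ∀ s : ℝ, ∫ h in ball (0 : Eu n) r, secondDiff (secondDiff u h) (s • V) y / s ^ 2 =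
      secondDiff (ballSecondDiff u r) (s • V) y / s ^ 2 := fun s => by
    rw [integral_div]
    congr 1
    have hi := H.integrableOn_secondDiff r
    unfold ballSecondDiff
    rw [secondDiff, ← integral_add (hi _) (hi _), ← integral_const_mul,
      ← integral_sub ((hi _).fun_add (hi _)) ((hi _).const_mul 2)]
    rfl
  refine Tendsto.congr hcongr ?_
  refine tendsto_integral_filter_of_dominated_convergence (fun _ => 4 * (Lam * ‖V‖ ^ 2)) ?_ ?_ ?_ ?_
  · refine Eventually.of_forall fun s => Continuous.aestronglyMeasurable ?_
    have := H.continuous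
    unfold secondDiff
    fun_prop
  · filter_upwards [self_mem_nhdsWithin] with s hs
    refine Eventually.of_forall fun h => ?_
    have hs0 : (0 : ℝ) < s := hs
    have h1 := fun x => H.secondDiff_smul_div_le V x hs0
    have h2 : ∀ x, 0 ≤ secondDiff u (s • V) x / s ^ 2 := fun x =>
      div_nonneg (H.secondDiff_nonneg _ _) (sq_nonneg s)
    have h3 : secondDiff (secondDiff u h) (s • V) y / s ^ 2 =
        secondDiff u (s • V) (y + h) / s ^ 2 + secondDiff u (s • V) (y - h) / s ^ 2 -
          2 * (secondDiff u (s • V) y / s ^ 2) := by rw [secondDiff_comm]; ring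
    rw [h3, Real.norm_eq_abs, abs_le]
    constructor <;> linarith [h1 (y + h), h1 (y - h), h1 y, h2 (y + h), h2 (y - h), h2 y]
  · exact integrableOn_const measure_ball_lt_top.ne
  · exact Eventually.of_forall fun h => tendsto_secondDiff_secondDiff H.contDiff h y V

end HessianControl
end Liouville

section Liouville

open Filter Topology Set Metric

lemma secondDiff_norm_sub_sq {n : ℕ} (z0 k y : Eu n) :
    secondDiff (fun x => ‖x - z0‖ ^ 2) k y = 2 * ‖k‖ ^ 2 := by
  have h := parallelogram_law_with_norm ℝ (y - z0) k
  have e1 : y + k - z0 = y - z0 + k := by abel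
  have e2 : y - k - z0 = y - z0 - k := by abel
  simp only [secondDiff, e1, e2]
  linarith

namespace HessianControl

variable {n : ℕ} {u : Eu n → ℝ} {lam Lam K : ℝ}

/-- Near any point there is a point where the Hessian in a given direction is almost as large,
and around which the Hessian has small mean oscillation. -/
lemma exists_small_oscillation (H : HessianControl u lam Lam K) (hLam : 0 < Lam)
    (hK : 0 ≤ K) (z0 v : Eu n) {t r ε : ℝ} (ht : 0 < t) (hr : 0 < r) (hε : 0 < ε) :
    ∃ y ∈ closedBall z0 t, hessQuad u z0 v - 3 * ε ≤ hessQuad u y v ∧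
      ∀ z, ∫ h in ball (0 : Eu n) r, (hessQuad u (y + h) z - hessQuad u y z) ^ 2 ≤
        K * ‖z‖ ^ 4 * (2 * (ε + Lam * ‖v‖ ^ 2 + 1) * n * Lam ^ 2 * r ^ 2 / (t ^ 2 * ε)) *
          volume.real (ball (0 : Eu n) r) := by
  obtain ⟨s, hs, -, hsu⟩ := exists_uniform_secondDiff H.contDiff z0 v t hε one_pos
  set m := volume.real (ball (0 : Eu n) r) with hm
  have hm0 : 0 < m := ENNReal.toReal_pos (measure_ball_pos volume _ hr).ne' measure_ball_lt_top.ne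
  set K' := ε / (Lam * r ^ 2 * m) with hK'
  have hK'0 : 0 < K' := by positivity
  set C1 := ε + Lam * ‖v‖ ^ 2 + 1 with hC1
  have hC10 : 0 < C1 := by positivity
  set w := fun x => secondDiff u (s • v) x / s ^ 2 with hw
  set Φ := fun x => K' * ballSecondDiff u r x + w x - C1 * ‖x - z0‖ ^ 2 / t ^ 2 with hΦ
  have hKP : ∀ x, 0 ≤ K' * ballSecondDiff u r x ∧ K' * ballSecondDiff u r x ≤ ε := fun x => by
    refine ⟨mul_nonneg hK'0.le (H.ballSecondDiff_nonneg r x), ?_⟩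
    calc K' * ballSecondDiff u r x ≤ K' * (Lam * r ^ 2 * m) := by
          gcongr; exact H.ballSecondDiff_le hLam.le r x
      _ = ε := by rw [hK']; field_simp
  have hw0 : ∀ x, 0 ≤ w x := fun x => div_nonneg (H.secondDiff_nonneg _ _) (sq_nonneg s)
  have hΦc : Continuous Φ := by
    have h1 := H.continuous_ballSecondDiff hLam.le r
    have h2 := continuous_secondDiff H.continuous (s • v)
    fun_prop
  obtain ⟨y, hy, hymax⟩ := (isCompact_closedBall z0 t).exists_isMaxOn
    ⟨z0, mem_closedBall_self ht.le⟩ hΦc.continuousOn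
  have hyz : Φ z0 ≤ Φ y := hymax (mem_closedBall_self ht.le)
  have hΦz : Φ z0 = K' * ballSecondDiff u r z0 + w z0 := by simp [hΦ]
  have hyb : y ∈ ball z0 t := by
    rw [mem_closedBall, dist_eq_norm] at hy
    rw [mem_ball, dist_eq_norm]
    refine lt_of_le_of_ne hy fun hyt => ?_
    have h1 : Φ y = K' * ballSecondDiff u r y + w y - C1 := by
      simp only [hΦ, hyt]; field_simp
    have h2 := H.secondDiff_smul_div_le v y hs
    linarith [hKP y, hKP z0, hw0 z0]
  have hloc : IsLocalMax Φ y := hymax.isLocalMax (mem_of_superset (isOpen_ball.mem_nhds hyb)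
    ball_subset_closedBall)
  refine ⟨y, hy, ?_, fun z => ?_⟩
  · have h1 := abs_le.1 (hsu y hy)
    have h2 := abs_le.1 (hsu z0 (mem_closedBall_self ht.le))
    have h3 : Φ y ≤ K' * ballSecondDiff u r y + w y := by
      simp only [hΦ]
      have : 0 ≤ C1 * ‖y - z0‖ ^ 2 / t ^ 2 := by positivity
      linarith
    simp only [hw] at h3 hΦz
    linarith [hKP y, hKP z0]
  set J := fun V : Eu n => ∫ h in ball (0 : Eu n) r,
    (hessQuad u (y + h) V + hessQuad u (y - h) V - 2 * hessQuad u y V) with hJ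
  have hlim : ∀ V, K' * J V + (hessQuad u (y + s • v) V + hessQuad u (y - s • v) V -
      2 * hessQuad u y V) / s ^ 2 - C1 * (2 * ‖V‖ ^ 2) / t ^ 2 ≤ 0 := fun V => by
    refine hloc.secondDiff_limit_nonpos (v := V) ?_
    have h1 := ((H.tendsto_secondDiff_ballSecondDiff r y V).const_mul K').add
      ((tendsto_secondDiff_secondDiff H.contDiff (s • v) y V).div_const (s ^ 2))
    have h2 := h1.sub_const (C1 * (2 * ‖V‖ ^ 2) / t ^ 2)
    refine h2.congr' ?_
    filter_upwards [self_mem_nhdsWithin] with σ hσ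
    have hσ0 : (0 : ℝ) < σ := hσ
    have h3 := secondDiff_norm_sub_sq z0 (σ • V) y
    rw [norm_smul, Real.norm_of_nonneg hσ0.le] at h3
    have h4 : secondDiff Φ (σ • V) y = K' * secondDiff (ballSecondDiff u r) (σ • V) y +
        secondDiff (secondDiff u (s • v)) (σ • V) y / s ^ 2 -
        C1 * secondDiff (fun x => ‖x - z0‖ ^ 2) (σ • V) y / t ^ 2 := by
      simp only [secondDiff, hΦ, hw]; ring
    rw [h4, h3]
    field_simp
  obtain ⟨V, -, hV2, hV3⟩ := H.frame y
  have hsq : ∀ x, 0 ≤ K * ‖z‖ ^ 4 * ∑ k, (hessQuad u x (V k) - hessQuad u y (V k)) := fun x =>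
    (sq_nonneg _).trans (hV3 x z)
  have hcont := fun V => continuous_hessQuad H.contDiff V
  have hIntOn : ∀ f : Eu n → ℝ, Continuous f → IntegrableOn f (ball (0 : Eu n) r) := fun f hf =>
    (hf.continuousOn.integrableOn_compact
      (isCompact_closedBall (0 : Eu n) r)).mono_set ball_subset_closedBall
  have hc : ∀ V, Continuous fun h => hessQuad u (y + h) V := fun V =>
    (hcont V).comp (by fun_prop)
  have hc' : ∀ V, Continuous fun h => hessQuad u (y - h) V := fun V =>
    (hcont V).comp (by fun_prop)
  have hkey : ∫ h in ball (0 : Eu n) r, (hessQuad u (y + h) z - hessQuad u y z) ^ 2 ≤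
      K * ‖z‖ ^ 4 * ∑ k, J (V k) := by
    rw [hJ, ← integral_finsetSum _ fun k _ => hIntOn _ (by
      have := hc (V k); have := hc' (V k); fun_prop), ← integral_const_mul]
    refine setIntegral_mono (hIntOn _ (by have := hc z; fun_prop)) (hIntOn _ ?_) fun h => ?_
    · have : ∀ k, Continuous fun h => hessQuad u (y + h) (V k) + hessQuad u (y - h) (V k) -
          2 * hessQuad u y (V k) := fun k => by
        have := hc (V k); have := hc' (V k); fun_prop
      exact continuous_const.mul (continuous_finsetSum _ fun k _ => this k)
    · have h1 := hV3 (y + h) z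
      have h2 := hsq (y - h)
      have h3 : ∑ k, (hessQuad u (y + h) (V k) + hessQuad u (y - h) (V k) -
          2 * hessQuad u y (V k)) = ∑ k, (hessQuad u (y + h) (V k) - hessQuad u y (V k)) +
          ∑ k, (hessQuad u (y - h) (V k) - hessQuad u y (V k)) := by
        rw [← Finset.sum_add_distrib]; exact Finset.sum_congr rfl fun k _ => by ring
      simp only [h3, mul_add]
      linarith
  rcases (by positivity : 0 ≤ K * ‖z‖ ^ 4).eq_or_lt with h0 | h0
  · rw [← h0] at hkey ⊢
    simpa using hkey
  have hpos : ∀ x, 0 ≤ ∑ k, (hessQuad u x (V k) - hessQuad u y (V k)) := fun x =>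
    nonneg_of_mul_nonneg_right (hsq x) h0
  have hsum := Finset.sum_nonpos fun k (_ : k ∈ Finset.univ) => hlim (V k)
  have hsum' : K' * ∑ k, J (V k) + (∑ k, (hessQuad u (y + s • v) (V k) - hessQuad u y (V k)) +
      ∑ k, (hessQuad u (y - s • v) (V k) - hessQuad u y (V k))) / s ^ 2 -
      C1 * (2 * ∑ k, ‖V k‖ ^ 2) / t ^ 2 ≤ 0 := by
    refine le_of_eq_of_le ?_ hsum
    simp only [Finset.sum_sub_distrib, Finset.sum_add_distrib, ← Finset.sum_div, ← Finset.mul_sum]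
    ring
  have h5 : 0 ≤ (∑ k, (hessQuad u (y + s • v) (V k) - hessQuad u y (V k)) +
      ∑ k, (hessQuad u (y - s • v) (V k) - hessQuad u y (V k))) / s ^ 2 :=
    div_nonneg (add_nonneg (hpos _) (hpos _)) (sq_nonneg s)
  have h6 : C1 * (2 * ∑ k, ‖V k‖ ^ 2) / t ^ 2 ≤ C1 * (2 * (n * Lam)) / t ^ 2 := by
    gcongr; exact frame_sum_norm_sq_le hV2
  have h7 : ∑ k, J (V k) ≤ (C1 * (2 * (n * Lam)) / t ^ 2) / K' := by
    rw [le_div_iff₀ hK'0]; linarith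
  refine hkey.trans ?_
  rw [mul_assoc (K * ‖z‖ ^ 4)]
  refine mul_le_mul_of_nonneg_left (h7.trans (le_of_eq ?_)) h0.le
  rw [hK']
  field_simp

end HessianControl
end Liouville

section Liouville

open Filter Topology Set Metric

lemma exists_pos_le_mul_sq_le (M : ℝ) {c δ : ℝ} (hM : 0 ≤ M) (hc : 0 < c) (hδ : 0 < δ) :
    ∃ μ, 0 < μ ∧ μ ≤ δ ∧ M * μ ^ 2 ≤ c := by
  refine ⟨min δ (min 1 (c / (M + 1))), by positivity, min_le_left _ _, ?_⟩
  set μ := min δ (min 1 (c / (M + 1))) with hμ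
  have h0 : 0 < μ := by positivity
  have h1 : μ ≤ 1 := (min_le_right _ _).trans (min_le_left _ _)
  have h2 : μ ≤ c / (M + 1) := (min_le_right _ _).trans (min_le_right _ _)
  rw [le_div_iff₀ (by positivity)] at h2
  nlinarith [mul_nonneg hM h0.le]

lemma setIntegral_ball_translate {n : ℕ} (F : Eu n → ℝ) (y : Eu n) (r : ℝ) :
    ∫ h in ball (0 : Eu n) r, F (y + h) = ∫ p in ball y r, F p := by
  have h1 := (measurePreserving_add_left (volume : Measure (Eu n)) y).setIntegral_preimage_emb
    (MeasurableEquiv.addLeft y).measurableEmbedding F (ball y r)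
  rw [← h1]
  congr 2
  ext p
  simp [mem_ball, dist_eq_norm]

lemma volume_real_ball_mul {n : ℕ} {μ r : ℝ} (hμ : 0 < μ) :
    volume.real (ball (0 : Eu n) (μ * r)) = μ ^ n * volume.real (ball (0 : Eu n) r) := by
  rw [measureReal_def, Measure.addHaar_ball_mul_of_pos volume 0 hμ r, ENNReal.toReal_mul,
    ENNReal.toReal_ofReal (by positivity), measureReal_def]
  simp

namespace HessianControl

variable {n : ℕ} {u : Eu n → ℝ} {lam Lam K : ℝ}

lemma exists_upper_bound_near (H : HessianControl u lam Lam K) (hLam : 0 < Lam)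
    (hK : 0 ≤ K) {κ : ℝ} (hκ : 0 < κ) :
    ∃ η, 0 < η ∧ η ≤ 1 ∧ ∀ R, 0 < R → ∃ x0 ∈ closedBall (0 : Eu n) R, ∀ v : Eu n, ‖v‖ ^ 2 ≤ Lam →
      ∀ x ∈ closedBall x0 (η * R / 2), hessQuad u x v ≤ hessQuad u x0 v + κ := by
  set ε := κ / 10 with hε
  have hε0 : 0 < ε := by positivity
  obtain ⟨μ, hμ0, hμ4, hμ⟩ := exists_pos_le_mul_sq_le
    (2 * (K * Lam ^ 2 * (2 * (ε + Lam * Lam + 1) * n * Lam ^ 2 * 16 / ε))) (c := κ ^ 2 / 8)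
    (δ := 1 / 4) (by positivity) (by positivity) (by positivity)
  obtain ⟨η, hη0, hη1, hη⟩ := exists_pos_le_mul_sq_le
    (2 * (K * Lam ^ 2 * (4 * n * Lam ^ 2))) (c := μ ^ n * (κ ^ 2 / 8))
    (δ := 1) (by positivity) (by positivity) (by positivity)
  refine ⟨η, hη0, hη1, fun R hR => ?_⟩
  have hr : 0 < η * R := by positivity
  set r := η * R with hrdef
  obtain ⟨x0, hx0, -, hosc0⟩ := H.exists_small_oscillation hLam hK 0 0 hR hr one_pos
  refine ⟨x0, hx0, fun v hv x hx => ?_⟩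
  have hr' : 0 < μ * r := by positivity
  obtain ⟨y, hy, hyv, hosc⟩ := H.exists_small_oscillation hLam hK x v (t := r / 4) (r := μ * r)
    (ε := ε) (by positivity) hr' hε0
  have hv4 : ‖v‖ ^ 4 ≤ Lam ^ 2 := by
    have : ‖v‖ ^ 4 = (‖v‖ ^ 2) ^ 2 := by ring
    rw [this]; gcongr
  set m := volume.real (ball (0 : Eu n) r) with hm
  have hm0 : 0 < m := ENNReal.toReal_pos (measure_ball_pos volume _ hr).ne' measure_ball_lt_top.ne
  have hm' : volume.real (ball (0 : Eu n) (μ * r)) = μ ^ n * m := volume_real_ball_mul hμ0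
  have h0 := hosc0 v
  have h1 := hosc v
  rw [setIntegral_ball_translate (fun p => (hessQuad u p v - hessQuad u x0 v) ^ 2)] at h0
  rw [setIntegral_ball_translate (fun p => (hessQuad u p v - hessQuad u y v) ^ 2), hm'] at h1
  have hsub : ball y (μ * r) ⊆ ball x0 r := by
    refine ball_subset_ball' ?_
    rw [mem_closedBall] at hx hy
    have := dist_triangle y x x0
    nlinarith
  have hcont := continuous_hessQuad H.contDiff v
  have hIntOn : ∀ f : Eu n → ℝ, Continuous f → ∀ p ρ, IntegrableOn f (ball (p : Eu n) ρ) :=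
    fun f hf p ρ => (hf.continuousOn.integrableOn_compact
      (isCompact_closedBall p ρ)).mono_set ball_subset_closedBall
  have h2 : ∫ p in ball y (μ * r), (hessQuad u p v - hessQuad u x0 v) ^ 2 ≤
      ∫ p in ball x0 r, (hessQuad u p v - hessQuad u x0 v) ^ 2 :=
    setIntegral_mono_set (hIntOn _ (by fun_prop) _ _)
      (Eventually.of_forall fun p => sq_nonneg _) hsub.eventuallyLE
  have h3 : (hessQuad u y v - hessQuad u x0 v) ^ 2 * (μ ^ n * m) ≤
      2 * (∫ p in ball y (μ * r), (hessQuad u p v - hessQuad u y v) ^ 2) +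
      2 * ∫ p in ball y (μ * r), (hessQuad u p v - hessQuad u x0 v) ^ 2 := by
    have h4 : ∫ _p in ball y (μ * r), (hessQuad u y v - hessQuad u x0 v) ^ 2 =
        (hessQuad u y v - hessQuad u x0 v) ^ 2 * (μ ^ n * m) := by
      rw [setIntegral_const, smul_eq_mul, mul_comm, ← hm', measureReal_def, measureReal_def,
        Measure.addHaar_ball_center]
    rw [← h4, ← integral_const_mul, ← integral_const_mul, ← integral_add]
    · refine setIntegral_mono (hIntOn _ (by fun_prop) _ _) (hIntOn _ (by fun_prop) _ _) fun p => ?_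
      have := sq_nonneg ((hessQuad u p v - hessQuad u y v) + (hessQuad u p v - hessQuad u x0 v))
      simp only
      nlinarith
    · exact hIntOn _ (by fun_prop) _ _
    · exact hIntOn _ (by fun_prop) _ _
  have h5 : ∫ p in ball y (μ * r), (hessQuad u p v - hessQuad u y v) ^ 2 ≤
      K * Lam ^ 2 * (2 * (ε + Lam * Lam + 1) * n * Lam ^ 2 * 16 / ε) * μ ^ 2 * (μ ^ n * m) := by
    refine h1.trans ?_
    calc _ ≤ K * Lam ^ 2 * (2 * (ε + Lam * Lam + 1) * n * Lam ^ 2 * (μ * r) ^ 2 /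
          ((r / 4) ^ 2 * ε)) * (μ ^ n * m) := by gcongr
      _ = _ := by field_simp; ring
  have h6 : ∫ p in ball x0 r, (hessQuad u p v - hessQuad u x0 v) ^ 2 ≤
      K * Lam ^ 2 * (4 * n * Lam ^ 2) * η ^ 2 * m := by
    refine h0.trans ?_
    calc _ ≤ K * Lam ^ 2 * (2 * (1 + Lam * ‖(0 : Eu n)‖ ^ 2 + 1) * n * Lam ^ 2 * r ^ 2 /
          (R ^ 2 * 1)) * m := by gcongr
      _ = _ := by rw [hrdef, norm_zero]; field_simp; ring
  have h7 : (hessQuad u y v - hessQuad u x0 v) ^ 2 * (μ ^ n * m) ≤ (κ / 2) ^ 2 * (μ ^ n * m) := by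
    have h8 := mul_le_mul_of_nonneg_right hμ (by positivity : 0 ≤ μ ^ n * m)
    have h9 := mul_le_mul_of_nonneg_right hη hm0.le
    linarith
  have h10 := abs_le_of_sq_le_sq' (le_of_mul_le_mul_right h7 (by positivity)) (by positivity)
  linarith [h10.2]

end HessianControl
end Liouville

section Liouville

open Filter Topology Set Metric

lemma hasDerivAt_exp_quadratic (γ a b c s : ℝ) :
    HasDerivAt (fun s : ℝ => Real.exp (-γ * (a + 2 * b * s + c * s ^ 2)))
      (Real.exp (-γ * (a + 2 * b * s + c * s ^ 2)) * (-γ * (2 * b + 2 * c * s))) s := by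
  have := ((((hasDerivAt_id s).const_mul (2 * b)).const_add a).fun_add
    ((hasDerivAt_pow 2 s).const_mul c)).const_mul (-γ)
  refine HasDerivAt.exp (this.congr_deriv ?_)
  norm_num
  left
  ring

lemma hasDerivAt_linear_mul_exp (a₀ a₁ d γ a b c s : ℝ) : HasDerivAt
    (fun s : ℝ => (a₀ + a₁ * s) * (Real.exp (-γ * (a + 2 * b * s + c * s ^ 2)) - d))
    (a₁ * (Real.exp (-γ * (a + 2 * b * s + c * s ^ 2)) - d) + (a₀ + a₁ * s) *
      (Real.exp (-γ * (a + 2 * b * s + c * s ^ 2)) * (-γ * (2 * b + 2 * c * s)))) s := by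
  have hlin : HasDerivAt (fun s : ℝ => a₀ + a₁ * s) a₁ s := by
    simpa using ((hasDerivAt_id s).const_mul a₁).const_add a₀
  exact hlin.mul ((hasDerivAt_exp_quadratic γ a b c s).sub_const d)

lemma tendsto_second_quotient_mul_exp (a₀ a₁ d γ a b c : ℝ) :
    Tendsto (fun s : ℝ => ((a₀ + a₁ * s) * (Real.exp (-γ * (a + 2 * b * s + c * s ^ 2)) - d) +
        (a₀ + a₁ * (-s)) * (Real.exp (-γ * (a + 2 * b * (-s) + c * (-s) ^ 2)) - d) -
        2 * (a₀ * (Real.exp (-γ * a) - d))) / s ^ 2) (𝓝[>] 0)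
      (𝓝 (Real.exp (-γ * a) * (a₀ * (4 * γ ^ 2 * b ^ 2 - 2 * γ * c) - 4 * γ * a₁ * b))) := by
  have hlin : HasDerivAt (fun s : ℝ => a₀ + a₁ * s) a₁ 0 := by
    simpa using ((hasDerivAt_id (0 : ℝ)).const_mul a₁).const_add a₀
  have hexp := hasDerivAt_exp_quadratic γ a b c 0
  have h2 := ((hexp.sub_const d).const_mul a₁).fun_add (hlin.mul (hexp.fun_mul
    ((((hasDerivAt_id (0 : ℝ)).const_mul (2 * c)).const_add (2 * b)).const_mul (-γ))))
  have h3 := tendsto_symm_second_quotient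
    (Eventually.of_forall (hasDerivAt_linear_mul_exp a₀ a₁ d γ a b c)) h2
  have h4 : ∀ x y : ℝ, x = y → 𝓝 x = 𝓝 y := fun x y h => by rw [h]
  refine (h3.congr fun s => ?_).trans (h4 _ _ ?_).le
  · simp
  · simp; ring

namespace HessianControl

variable {n : ℕ} {u : Eu n → ℝ} {lam Lam K : ℝ}

lemma frame_sum_nonneg [NeZero n] (hK : 0 < K) {x y : Eu n} {V : Fin n → Eu n}
    (hV : ∀ y z, (hessQuad u y z - hessQuad u x z) ^ 2 ≤
      K * ‖z‖ ^ 4 * ∑ k, (hessQuad u y (V k) - hessQuad u x (V k))) :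
    0 ≤ ∑ k, (hessQuad u y (V k) - hessQuad u x (V k)) := by
  have h := (sq_nonneg _).trans (hV y (EuclideanSpace.single 0 1))
  simp only [PiLp.norm_single, norm_one, one_pow, mul_one] at h
  exact nonneg_of_mul_nonneg_right h hK

lemma norm_add_smul_sub_sq (y x0 V : Eu n) (s : ℝ) :
    ‖y + s • V - x0‖ ^ 2 = ‖y - x0‖ ^ 2 + 2 * inner ℝ (y - x0) V * s + ‖V‖ ^ 2 * s ^ 2 := by
  have : y + s • V - x0 = (y - x0) + s • V := by abel
  rw [this, norm_add_sq_real, inner_smul_right, norm_smul, mul_pow, Real.norm_eq_abs, sq_abs]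
  ring

/-- A radial exponential barrier spreads an upper bound on the Hessian from a ball to a larger
concentric ball. -/
lemma hessQuad_le_sub_barrier [NeZero n] (H : HessianControl u lam Lam K)
    (hlam : 0 ≤ lam) (hK : 0 < K) {x0 v : Eu n} {m κ ρ R γ : ℝ} (hκ : 0 < κ) (hρ : 0 < ρ)
    (hR : 0 ≤ R) (hγ : 0 < γ) (hγρ : n * Lam < 2 * γ * lam * ρ ^ 2) (hm : ∀ x, hessQuad u x v ≤ m)
    (hin : ∀ x ∈ closedBall x0 (2 * ρ), hessQuad u x v ≤ m - κ) :
    ∀ x ∈ closedBall x0 R,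
      hessQuad u x v ≤ m - κ * (Real.exp (-γ * ‖x - x0‖ ^ 2) - Real.exp (-γ * R ^ 2)) := by
  intro x hx
  refine le_of_tendsto (tendsto_secondDiff H.contDiff.contDiffAt v) ?_
  have hsmall : ∀ᶠ s : ℝ in 𝓝[>] 0, s * ‖v‖ < ρ := by
    refine nhdsWithin_le_nhds ?_
    have : Tendsto (fun s : ℝ => s * ‖v‖) (𝓝 0) (𝓝 (0 * ‖v‖)) :=
      (continuous_id.mul continuous_const).tendsto 0
    rw [zero_mul] at this
    exact this.eventually (gt_mem_nhds hρ)
  filter_upwards [hsmall, self_mem_nhdsWithin] with s hsv hs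
  have hs0 : (0 : ℝ) < s := hs
  set w := fun x => secondDiff u (s • v) x / s ^ 2 with hw
  have hwavg : ∀ x, ∃ h : Eu n, ‖h‖ ≤ ρ ∧
      w x = (hessQuad u (x + h) v + hessQuad u (x - h) v) / 2 := fun x => by
    obtain ⟨ξ, hξ, hξe⟩ := exists_secondDiff_eq H.contDiff x (s • v)
    refine ⟨ξ • s • v, ?_, ?_⟩
    · rw [norm_smul, norm_smul, Real.norm_of_nonneg hξ.1.le, Real.norm_of_nonneg hs0.le]
      have : 0 ≤ s * ‖v‖ := by positivity
      nlinarith [hξ.1, hξ.2]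
    · simp only [hw, hξe, hessQuad_smul]
      field_simp
  have hwm : ∀ x, w x ≤ m := fun x => by
    obtain ⟨h, -, he⟩ := hwavg x
    linarith [hm (x + h), hm (x - h)]
  have hwin : ∀ x ∈ closedBall x0 ρ, w x ≤ m - κ := fun x hx => by
    obtain ⟨h, hh, he⟩ := hwavg x
    rw [mem_closedBall, dist_eq_norm] at hx
    have h1 := hin (x + h) (by
      rw [mem_closedBall, dist_eq_norm, add_sub_right_comm]
      linarith [norm_add_le (x - x0) h])
    have h2 := hin (x - h) (by
      rw [mem_closedBall, dist_eq_norm, sub_right_comm]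
      linarith [norm_sub_le (x - x0) h])
    linarith
  set e := Real.exp (-γ * R ^ 2) with he
  set Φ := fun x => w x + κ * (Real.exp (-γ * ‖x - x0‖ ^ 2) - e) with hΦ
  suffices h : ∀ x ∈ closedBall x0 R, Φ x ≤ m by
    have := h x hx
    simp only [hΦ] at this
    linarith
  have hΦc : Continuous Φ := by
    have h2 := continuous_secondDiff H.continuous (s • v)
    fun_prop
  obtain ⟨y, hy, hymax⟩ := (isCompact_closedBall x0 R).exists_isMaxOn
    ⟨x0, mem_closedBall_self hR⟩ hΦc.continuousOn
  refine fun x hx => (hymax hx).trans ?_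
  by_contra! hcon
  rw [mem_closedBall, dist_eq_norm] at hy
  have hyR : ‖y - x0‖ < R := by
    refine lt_of_le_of_ne hy fun h => ?_
    have : Φ y = w y := by simp [hΦ, h, he]
    linarith [hwm y]
  have hyρ : ρ < ‖y - x0‖ := by
    by_contra! h
    have h1 := hwin y (by rwa [mem_closedBall, dist_eq_norm])
    have h2 : Real.exp (-γ * ‖y - x0‖ ^ 2) ≤ 1 := Real.exp_le_one_iff.2 (by
      have : 0 ≤ γ * ‖y - x0‖ ^ 2 := by positivity
      linarith)
    have h3 : 0 < e := Real.exp_pos _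
    simp only [hΦ] at hcon
    nlinarith
  have hloc : IsLocalMax Φ y := hymax.isLocalMax (mem_of_superset
    (isOpen_ball.mem_nhds (show y ∈ ball x0 R by rwa [mem_ball, dist_eq_norm]))
    ball_subset_closedBall)
  set p := y - x0 with hp
  set g := Real.exp (-γ * ‖p‖ ^ 2) with hg
  have hg0 : 0 < g := Real.exp_pos _
  have hlim : ∀ V, (hessQuad u (y + s • v) V + hessQuad u (y - s • v) V -
      2 * hessQuad u y V) / s ^ 2 +
      κ * (g * (4 * γ ^ 2 * inner ℝ p V ^ 2 - 2 * γ * ‖V‖ ^ 2)) ≤ 0 := fun V => by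
    refine hloc.secondDiff_limit_nonpos (v := V) ?_
    have h1 := ((tendsto_secondDiff_secondDiff H.contDiff (s • v) y V).div_const (s ^ 2)).add
      ((tendsto_second_quotient_mul_exp 1 0 e γ (‖p‖ ^ 2) (inner ℝ p V) (‖V‖ ^ 2)).const_mul κ)
    simp only [one_mul, mul_zero, zero_mul, sub_zero, add_zero] at h1
    refine h1.congr fun σ => ?_
    have h3 := norm_add_smul_sub_sq y x0 V σ
    have h4 := norm_add_smul_sub_sq y x0 V (-σ)
    rw [neg_smul, ← sub_eq_add_neg] at h4
    rw [← hp] at h3 h4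
    have h5 : secondDiff Φ (σ • V) y = secondDiff (secondDiff u (s • v)) (σ • V) y / s ^ 2 +
        κ * ((Real.exp (-γ * ‖y + σ • V - x0‖ ^ 2) - e) +
        (Real.exp (-γ * ‖y - σ • V - x0‖ ^ 2) - e) -
        2 * (Real.exp (-γ * ‖y - x0‖ ^ 2) - e)) := by
      simp only [secondDiff, hΦ, hw]; ring
    rw [h5, h3, h4]
    ring
  obtain ⟨V, hV1, hV2, hV3⟩ := H.frame y
  have hsum := Finset.sum_nonpos fun k (_ : k ∈ Finset.univ) => hlim (V k)
  have hsum' : (∑ k, (hessQuad u (y + s • v) (V k) - hessQuad u y (V k)) +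
      ∑ k, (hessQuad u (y - s • v) (V k) - hessQuad u y (V k))) / s ^ 2 +
      κ * (g * (4 * γ ^ 2 * ∑ k, inner ℝ (V k) p ^ 2 - 2 * γ * ∑ k, ‖V k‖ ^ 2)) ≤ 0 := by
    refine le_of_eq_of_le ?_ hsum
    simp only [Finset.sum_sub_distrib, Finset.sum_add_distrib, ← Finset.sum_div, ← Finset.mul_sum,
      real_inner_comm p]
    ring
  have h5 : 0 ≤ (∑ k, (hessQuad u (y + s • v) (V k) - hessQuad u y (V k)) +
      ∑ k, (hessQuad u (y - s • v) (V k) - hessQuad u y (V k))) / s ^ 2 :=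
    div_nonneg (add_nonneg (frame_sum_nonneg hK hV3) (frame_sum_nonneg hK hV3)) (sq_nonneg s)
  have h6 : 0 < 4 * γ ^ 2 * ∑ k, inner ℝ (V k) p ^ 2 - 2 * γ * ∑ k, ‖V k‖ ^ 2 := by
    have h7 := frame_sum_norm_sq_le hV2
    have h8 : lam * ρ ^ 2 ≤ ∑ k, inner ℝ (V k) p ^ 2 :=
      le_trans (by gcongr) (hV1 p)
    have h9 : 2 * γ * (lam * ρ ^ 2) ≤ 2 * γ * ∑ k, inner ℝ (V k) p ^ 2 := by gcongr
    have : 0 < 2 * γ * (2 * γ * ∑ k, inner ℝ (V k) p ^ 2 - ∑ k, ‖V k‖ ^ 2) :=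
      mul_pos (by positivity) (by linarith)
    linarith
  have := mul_pos hκ (mul_pos hg0 h6)
  linarith

end HessianControl
end Liouville

section Liouville

open Filter Topology Set Metric

namespace HessianControl

variable {n : ℕ} {u : Eu n → ℝ} {lam Lam K : ℝ}

lemma bddAbove_hessQuad (H : HessianControl u lam Lam K) (v : Eu n) :
    BddAbove (range fun x => hessQuad u x v) :=
  ⟨Lam * ‖v‖ ^ 2, by rintro _ ⟨x, rfl⟩; exact H.le x v⟩

lemma hessQuad_le_of_near (H : HessianControl u lam Lam K) (hLam : 0 < Lam) {τ : ℝ} (hτ : 0 < τ) :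
    ∃ δ > 0, ∀ a b : Eu n, ‖b‖ ^ 2 ≤ Lam → ‖a - b‖ < δ → ∀ x,
      hessQuad u x a ≤ hessQuad u x b + τ := by
  obtain ⟨σ, hσ0, -, hσ⟩ := exists_pos_le_mul_sq_le (Lam * Lam) (c := τ / 2) (δ := 1)
    (by positivity) (by positivity) one_pos
  obtain ⟨δ, hδ0, -, hδ⟩ := exists_pos_le_mul_sq_le ((1 + (σ⁻¹) ^ 2) * Lam) (c := τ / 2) (δ := 1)
    (by positivity) (by positivity) one_pos
  refine ⟨δ, hδ0, fun a b hb hab x => ?_⟩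
  set w := a - b with hw
  have ha : a = b + w := by rw [hw]; abel
  have h1 := H.nonneg x (σ • b - σ⁻¹ • w)
  have h2 : hessQuad u x (σ • b - σ⁻¹ • w) =
      (1 + σ ^ 2) * hessQuad u x b + (1 + σ⁻¹ ^ 2) * hessQuad u x w - hessQuad u x a := by
    rw [ha]
    simp only [hessQuad, map_sub, map_smul, map_add, sub_apply,
      add_apply, smul_apply, smul_eq_mul]
    field_simp
    ring
  have h3 : σ ^ 2 * hessQuad u x b ≤ τ / 2 := by
    refine le_trans ?_ hσ
    rw [mul_comm]
    refine mul_le_mul_of_nonneg_right ((H.le x b).trans ?_) (sq_nonneg σ)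
    gcongr
  have h4 : (1 + σ⁻¹ ^ 2) * hessQuad u x w ≤ τ / 2 := by
    refine le_trans ?_ hδ
    rw [mul_assoc]
    refine mul_le_mul_of_nonneg_left ((H.le x w).trans ?_) (by positivity)
    gcongr
  linarith

/-- If the Hessian is not constant, then on every large ball some second derivative stays a fixed
amount below its supremum. -/
lemma exists_gap [NeZero n] (H : HessianControl u lam Lam K) (hlam : 0 < lam) (hLam : 0 < Lam)
    (hK : 0 < K) {x₁ x₂ z : Eu n} (hne : hessQuad u x₁ z ≠ hessQuad u x₂ z) :
    ∃ θ > 0, ∀ R, 0 < R → ∃ v : Eu n, ‖v‖ ^ 2 ≤ Lam ∧ ∃ x', ∀ x ∈ closedBall (0 : Eu n) R,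
      hessQuad u x v + θ ≤ hessQuad u x' v := by
  have hz : z ≠ 0 := by
    rintro rfl
    simp [hessQuad] at hne
  have hn : (0 : ℝ) < n := by exact_mod_cast Nat.pos_of_ne_zero (NeZero.ne n)
  have hz4 : 0 < ‖z‖ ^ 4 := by positivity
  set d := hessQuad u x₁ z - hessQuad u x₂ z with hd
  have hd0 : 0 < d ^ 2 := by
    have : d ≠ 0 := sub_ne_zero.2 hne
    positivity
  set κ := d ^ 2 / (8 * (K * ‖z‖ ^ 4) * n) with hκ
  have hκ0 : 0 < κ := by positivity
  obtain ⟨η, hη0, hη1, hη⟩ := H.exists_upper_bound_near hLam hK.le hκ0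
  set α := n * Lam * 16 / (2 * lam * η ^ 2) + 1 with hα
  have hα0 : 0 < α := by positivity
  set θ := κ * (Real.exp (-α * 4) - Real.exp (-α * 9)) with hθ
  have hθ0 : 0 < θ := mul_pos hκ0 (sub_pos.2 (Real.exp_lt_exp.2 (by linarith)))
  refine ⟨θ / 2, by positivity, fun R hR => ?_⟩
  obtain ⟨x0, hx0, hup⟩ := hη R hR
  obtain ⟨V, hV1, hV2, hV3⟩ := H.frame x0
  have hex : ∃ k, ∃ x', hessQuad u x0 (V k) + 2 * κ ≤ hessQuad u x' (V k) := by
    by_contra! hcon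
    have hi : ∀ x', (hessQuad u x' z - hessQuad u x0 z) ^ 2 < d ^ 2 / 4 := fun x' => by
      refine (hV3 x' z).trans_lt ?_
      have h1 : ∑ k, (hessQuad u x' (V k) - hessQuad u x0 (V k)) < ∑ _k : Fin n, 2 * κ :=
        Finset.sum_lt_sum_of_nonempty ⟨0, Finset.mem_univ _⟩ fun k _ => by
          linarith [hcon k x']
      calc _ < K * ‖z‖ ^ 4 * ∑ _k : Fin n, 2 * κ := by gcongr
        _ = d ^ 2 / 4 := by
          simp only [Finset.sum_const, Finset.card_univ, Fintype.card_fin, nsmul_eq_mul, hκ]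
          field_simp
          ring
    have h1 := hi x₁
    have h2 := hi x₂
    have h3 : d = (hessQuad u x₁ z - hessQuad u x0 z) - (hessQuad u x₂ z - hessQuad u x0 z) := by
      rw [hd]; ring
    nlinarith [sq_nonneg ((hessQuad u x₁ z - hessQuad u x0 z) +
      (hessQuad u x₂ z - hessQuad u x0 z))]
  obtain ⟨k, x', hx'⟩ := hex
  have hv := frame_norm_sq_le hV2 k
  refine ⟨V k, hv, ?_⟩
  set m := ⨆ x, hessQuad u x (V k) with hm
  have hle : ∀ x, hessQuad u x (V k) ≤ m := le_ciSup (H.bddAbove_hessQuad (V k))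
  obtain ⟨x'', hx''⟩ := exists_lt_of_lt_ciSup (show m - θ / 2 < ⨆ x, hessQuad u x (V k) by
    rw [← hm]; linarith)
  refine ⟨x'', fun x hx => ?_⟩
  have hbar := H.hessQuad_le_sub_barrier hlam.le hK (x0 := x0) (v := V k) (m := m) (κ := κ)
    (ρ := η * R / 4) (R := 3 * R) (γ := α / R ^ 2) hκ0 (by positivity) (by positivity)
    (by positivity) ?_ hle ?_ x ?_
  · have h1 : -(α / R ^ 2) * (3 * R) ^ 2 = -α * 9 := by field_simp; norm_num
    have h2 : -α * 4 ≤ -(α / R ^ 2) * ‖x - x0‖ ^ 2 := by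
      have h3 : ‖x - x0‖ ≤ 2 * R := by
        rw [mem_closedBall, dist_zero_right] at hx hx0
        linarith [norm_sub_le x x0]
      have h4 : α / R ^ 2 * ‖x - x0‖ ^ 2 ≤ α / R ^ 2 * (2 * R) ^ 2 := by gcongr
      have h5 : α / R ^ 2 * (2 * R) ^ 2 = α * 4 := by field_simp; norm_num
      linarith
    rw [h1] at hbar
    have h3 : θ ≤ κ * (Real.exp (-(α / R ^ 2) * ‖x - x0‖ ^ 2) - Real.exp (-α * 9)) := by
      rw [hθ]
      gcongr
    linarith
  · have : 2 * (α / R ^ 2) * lam * (η * R / 4) ^ 2 = n * Lam + 2 * lam * η ^ 2 / 16 := by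
      rw [hα]; field_simp; ring
    rw [this]
    have : 0 < 2 * lam * η ^ 2 / 16 := by positivity
    linarith
  · intro x hx
    have h1 := hup (V k) hv x (by convert hx using 2; ring)
    linarith [hle x']
  · rw [mem_closedBall, dist_eq_norm]
    rw [mem_closedBall, dist_zero_right] at hx hx0
    linarith [norm_sub_le x x0]

/-- A Liouville theorem: an entire function with controlled Hessian is quadratic. -/
theorem hessQuad_const [NeZero n] (H : HessianControl u lam Lam K) (hlam : 0 < lam)
    (hLam : 0 < Lam) (hK : 0 < K) (x y z : Eu n) : hessQuad u x z = hessQuad u y z := by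
  by_contra hne
  obtain ⟨θ, hθ, hgap⟩ := H.exists_gap hlam hLam hK hne
  choose v hv x' hx' using fun k : ℕ => hgap (k + 1) (by positivity)
  have hvb : ∀ k, v k ∈ closedBall (0 : Eu n) (√Lam) := fun k => by
    rw [mem_closedBall, dist_zero_right]
    exact Real.le_sqrt_of_sq_le (hv k)
  obtain ⟨w, hw, φ, hφ, hlim⟩ := (isCompact_closedBall (0 : Eu n) (√Lam)).tendsto_subseq hvb
  have hwL : ‖w‖ ^ 2 ≤ Lam := by
    rw [mem_closedBall, dist_zero_right] at hw
    exact (Real.le_sqrt (norm_nonneg w) hLam.le).1 hw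
  obtain ⟨δ, hδ, hnear⟩ := H.hessQuad_le_of_near hLam (τ := θ / 4) (by positivity)
  set m := ⨆ x, hessQuad u x w with hm
  have key : ∀ x, hessQuad u x w ≤ m - θ / 2 := fun x => by
    obtain ⟨N, hN⟩ := exists_nat_ge ‖x‖
    obtain ⟨j, hj1, hj2⟩ := ((Metric.tendsto_atTop.1 hlim δ hδ).imp fun M hM =>
      And.intro (hM (max M N) (le_max_left _ _)) (le_max_right M N))
    set i := φ (max j N) with hi
    have hiN : N ≤ i := (le_max_right _ _).trans (hφ.id_le _)
    have hxi : x ∈ closedBall (0 : Eu n) ((i : ℝ) + 1) := by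
      rw [mem_closedBall, dist_zero_right]
      have : (N : ℝ) ≤ i := by exact_mod_cast hiN
      linarith
    have hd : ‖v i - w‖ < δ := by rw [← dist_eq_norm]; exact hj1
    have h1 := hnear w (v i) (hv i) (by rwa [norm_sub_rev]) x
    have h2 := hx' i x hxi
    have h3 := hnear (v i) w hwL hd (x' i)
    have h4 : hessQuad u (x' i) w ≤ m := le_ciSup (H.bddAbove_hessQuad w) (x' i)
    linarith
  have : m ≤ m - θ / 2 := ciSup_le key
  linarith

end HessianControl
end Liouville

section HalfSpace

open Filter Topology Set Metric

/-- The quadratic form of `Mb b ψ ln x`. -/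
def bHess {n : ℕ} (b : ℝ) (ψ : Eu n → ℝ) (ln : Fin n) (x z : Eu n) : ℝ :=
  hessQuad ψ x z + b * pd ψ ln x / x ln * z ln ^ 2

/-- An anisotropic squared distance to the point of height `R` above the origin. -/
def anisoSq {n : ℕ} (ln : Fin n) (ε₀ R : ℝ) (x : Eu n) : ℝ :=
  ε₀ * (‖x‖ ^ 2 - x ln ^ 2) + (x ln - R) ^ 2

/-- Half the directional derivative of `anisoSq` at `y` in direction `V`. -/
def anisoLin {n : ℕ} (ln : Fin n) (ε₀ R : ℝ) (y V : Eu n) : ℝ :=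
  ε₀ * (inner ℝ y V - y ln * V ln) + (y ln - R) * V ln

variable {n : ℕ} {ln : Fin n} {ε₀ R : ℝ}

lemma inner_single_one (V : Eu n) : inner ℝ V (EuclideanSpace.single ln (1 : ℝ)) = V ln := by
  simp [EuclideanSpace.inner_single_right]

lemma coord_sq_le_norm_sq (x : Eu n) : x ln ^ 2 ≤ ‖x‖ ^ 2 := by
  rw [EuclideanSpace.norm_sq_eq]
  have := Finset.single_le_sum (fun j _ => sq_nonneg ‖x j‖) (Finset.mem_univ ln)
  simpa using this

lemma anisoSq_line (y V : Eu n) (s : ℝ) :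
    anisoSq ln ε₀ R (y + s • V) = anisoSq ln ε₀ R y + 2 * anisoLin ln ε₀ R y V * s +
      anisoSq ln ε₀ 0 V * s ^ 2 := by
  simp only [anisoSq, anisoLin, norm_add_sq_real, inner_smul_right, norm_smul, mul_pow,
    Real.norm_eq_abs, sq_abs, PiLp.add_apply, PiLp.smul_apply, smul_eq_mul]
  ring

lemma continuous_anisoSq : Continuous (anisoSq ln ε₀ R) := by
  unfold anisoSq; fun_prop

lemma anisoSq_eq (y : Eu n) :
    anisoSq ln ε₀ R y =
      ε₀ * ‖y - y ln • EuclideanSpace.single ln (1 : ℝ)‖ ^ 2 + (y ln - R) ^ 2 := by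
  have he : ‖(EuclideanSpace.single ln (1 : ℝ) : Eu n)‖ = 1 := by simp
  rw [anisoSq, norm_sub_sq_real, inner_smul_right, norm_smul, inner_single_one, he, mul_one,
    Real.norm_eq_abs, sq_abs]
  ring

lemma anisoLin_eq_inner (y V : Eu n) :
    anisoLin ln ε₀ R y V =
      ε₀ * inner ℝ V (y - y ln • EuclideanSpace.single ln (1 : ℝ)) + (y ln - R) * V ln := by
  rw [inner_sub_right, inner_smul_right, inner_single_one, anisoLin, real_inner_comm]

lemma sum_anisoLin_sq_ge {lam : ℝ} (hlam : 0 ≤ lam) (h1 : ε₀ ≤ 1) (y : Eu n)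
    {V : Fin n → Eu n} (hV1 : ∀ z, lam * ‖z‖ ^ 2 ≤ ∑ k, inner ℝ (V k) z ^ 2) :
    lam * (ε₀ * anisoSq ln ε₀ R y) ≤ ∑ k, anisoLin ln ε₀ R y (V k) ^ 2 := by
  set e : Eu n := EuclideanSpace.single ln (1 : ℝ) with he
  have he1 : ‖e‖ = 1 := by simp [he]
  set y' : Eu n := y - y ln • e with hy'
  set p : Eu n := ε₀ • y' + (y ln - R) • e with hp
  have hy'e : inner ℝ y' e = 0 := by
    rw [hy', inner_sub_left, inner_smul_left, inner_single_one, real_inner_self_eq_norm_sq, he1]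
    simp
  have hpn : ‖p‖ ^ 2 = ε₀ ^ 2 * ‖y'‖ ^ 2 + (y ln - R) ^ 2 := by
    rw [hp, norm_add_sq_real, inner_smul_right, inner_smul_left, hy'e, norm_smul, norm_smul, he1,
      mul_pow, mul_pow, Real.norm_eq_abs, Real.norm_eq_abs, sq_abs, sq_abs]
    ring
  have hlinp : ∀ k, anisoLin ln ε₀ R y (V k) = inner ℝ (V k) p := by
    intro k
    rw [anisoLin_eq_inner, hp, inner_add_right, inner_smul_right, inner_smul_right,
      inner_single_one]
  simp only [hlinp]
  refine le_trans (mul_le_mul_of_nonneg_left ?_ hlam) (hV1 p)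
  rw [hpn, anisoSq_eq, ← he, ← hy', mul_add, ← mul_assoc, ← pow_two]
  have : ε₀ * (y ln - R) ^ 2 ≤ 1 * (y ln - R) ^ 2 :=
    mul_le_mul_of_nonneg_right h1 (sq_nonneg _)
  linarith

lemma sum_coord_mul_inner_lt {lam Lam : ℝ} (hlam : 0 < lam) (hLam : 0 < Lam)
    (hR : 0 < R) (hε₀ : ε₀ = (lam / (2 * Lam)) ^ 2) {y' : Eu n}
    (hy' : ε₀ * ‖y'‖ ^ 2 ≤ 2 * R ^ 2) {V : Fin n → Eu n}
    (hV2 : ∀ z, ∑ k, inner ℝ (V k) z ^ 2 ≤ Lam * ‖z‖ ^ 2) :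
    ε₀ * (∑ k, V k ln * inner ℝ (V k) y') < lam * R := by
  have hS2 : ∑ k, V k ln ^ 2 ≤ Lam := by
    simpa [inner_single_one] using hV2 (EuclideanSpace.single ln 1)
  refine lt_of_pow_lt_pow_left₀ 2 (by positivity) ?_
  have h1 := Finset.sum_mul_sq_le_sq_mul_sq Finset.univ (fun k => V k ln)
    (fun k => inner ℝ (V k) y')
  have h2 : (∑ k, V k ln ^ 2) * ∑ k, inner ℝ (V k) y' ^ 2 ≤ Lam * (Lam * ‖y'‖ ^ 2) :=
    mul_le_mul hS2 (hV2 y') (Finset.sum_nonneg fun _ _ => sq_nonneg _) hLam.le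
  have h4 : 4 * (ε₀ * Lam ^ 2) = lam ^ 2 := by rw [hε₀]; field_simp; norm_num
  have h0 : 0 ≤ ε₀ := by rw [hε₀]; positivity
  calc (ε₀ * ∑ k, V k ln * inner ℝ (V k) y') ^ 2
      = ε₀ ^ 2 * (∑ k, V k ln * inner ℝ (V k) y') ^ 2 := by ring
    _ ≤ ε₀ ^ 2 * (Lam * (Lam * ‖y'‖ ^ 2)) := by gcongr; exact h1.trans h2
    _ = (ε₀ * Lam ^ 2) * (ε₀ * ‖y'‖ ^ 2) := by ring
    _ ≤ (ε₀ * Lam ^ 2) * (2 * R ^ 2) := by gcongr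
    _ < (lam * R) ^ 2 := by
      have : 0 < lam ^ 2 * R ^ 2 := by positivity
      have h5 : (ε₀ * Lam ^ 2) * (2 * R ^ 2) = lam ^ 2 * R ^ 2 / 2 := by rw [← h4]; ring
      rw [h5, mul_pow]
      linarith

lemma sum_anisoSq_zero_le {Lam : ℝ} (h1 : ε₀ ≤ 1) {V : Fin n → Eu n}
    (hV2 : ∀ z, ∑ k, inner ℝ (V k) z ^ 2 ≤ Lam * ‖z‖ ^ 2) :
    ∑ k, anisoSq ln ε₀ 0 (V k) ≤ n * Lam := by
  refine (Finset.sum_le_sum fun k _ => ?_).trans (frame_sum_norm_sq_le hV2)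
  have h2 := coord_sq_le_norm_sq (ln := ln) (V k)
  have h3 := mul_le_mul_of_nonneg_right h1 (sub_nonneg.2 h2)
  rw [anisoSq, sub_zero]
  linarith

lemma barrier_core {lam Lam b γ η : ℝ} (hlam : 0 < lam) (hlL : lam ≤ Lam) (hb : 0 ≤ b)
    (hR : 0 < R) (hγ : 0 < γ) (hε₀ : ε₀ = (lam / (2 * Lam)) ^ 2)
    (hα : (n + b + 2) * Lam ≤ 2 * γ * R ^ 2 * lam * ε₀ * η ^ 2) {y : Eu n} (hy : 0 < y ln)
    (hy1 : η ^ 2 * R ^ 2 ≤ anisoSq ln ε₀ R y) (hy2 : anisoSq ln ε₀ R y ≤ 2 * R ^ 2)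
    {V : Fin n → Eu n} (hV1 : ∀ z, lam * ‖z‖ ^ 2 ≤ ∑ k, inner ℝ (V k) z ^ 2)
    (hV2 : ∀ z, ∑ k, inner ℝ (V k) z ^ 2 ≤ Lam * ‖z‖ ^ 2) :
    0 < -(b * (y ln - R) * ∑ k, V k ln ^ 2) +
      (y ln * (2 * γ * ∑ k, anisoLin ln ε₀ R y (V k) ^ 2 - ∑ k, anisoSq ln ε₀ 0 (V k)) -
      2 * ∑ k, V k ln * anisoLin ln ε₀ R y (V k)) := by
  have hLam : 0 < Lam := hlam.trans_le hlL
  have hε0 : 0 < ε₀ := by rw [hε₀]; positivity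
  have hε1 : ε₀ ≤ 1 := by
    rw [hε₀]
    refine pow_le_one₀ (by positivity) ?_
    rw [div_le_one (by positivity)]
    linarith
  set y' : Eu n := y - y ln • EuclideanSpace.single ln (1 : ℝ) with hy'
  have hρ := anisoSq_eq (ln := ln) (ε₀ := ε₀) (R := R) y
  have hcs := sum_coord_mul_inner_lt (ln := ln) (y' := y') hlam hLam hR hε₀
    (by linarith [sq_nonneg (y ln - R)]) hV2
  have hr1 := sum_anisoLin_sq_ge (ln := ln) (R := R) hlam.le hε1 y hV1
  have hr2 := sum_anisoSq_zero_le (ln := ln) hε1 hV2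
  have hS1 : lam ≤ ∑ k, V k ln ^ 2 := by
    simpa [inner_single_one] using hV1 (EuclideanSpace.single ln 1)
  have hS2 : ∑ k, V k ln ^ 2 ≤ Lam := by
    simpa [inner_single_one] using hV2 (EuclideanSpace.single ln 1)
  have hmix : ∑ k, V k ln * anisoLin ln ε₀ R y (V k) =
      ε₀ * (∑ k, V k ln * inner ℝ (V k) y') + (y ln - R) * ∑ k, V k ln ^ 2 := by
    rw [Finset.mul_sum, Finset.mul_sum, ← Finset.sum_add_distrib]
    exact Finset.sum_congr rfl fun k _ => by rw [anisoLin_eq_inner]; ring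
  rw [hmix]
  have h1 : 2 * γ * (lam * (ε₀ * (η ^ 2 * R ^ 2))) ≤
      2 * γ * ∑ k, anisoLin ln ε₀ R y (V k) ^ 2 := by
    refine mul_le_mul_of_nonneg_left (le_trans ?_ hr1) (by positivity)
    gcongr
  generalize ∑ k, anisoLin ln ε₀ R y (V k) ^ 2 = A1 at *
  generalize ∑ k, anisoSq ln ε₀ 0 (V k) = A2 at *
  generalize ε₀ * (∑ k, V k ln * inner ℝ (V k) y') = A3 at *
  generalize ∑ k, V k ln ^ 2 = S at *
  have h2 : (b + 2) * Lam ≤ 2 * γ * A1 - A2 := by linarith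
  have h3 := mul_le_mul_of_nonneg_left h2 hy.le
  have h4 : y ln * ((b + 2) * S) ≤ y ln * ((b + 2) * Lam) := by gcongr
  have h5 : (b + 2) * (lam * R) ≤ (b + 2) * (S * R) := by gcongr
  have h6 : 0 ≤ b * (lam * R) := by positivity
  linarith

end HalfSpace

section HalfSpace

open Filter Topology Set Metric

/-- The information about a solution in the half-space used for the rigidity of `∂ψ/∂xₙ / xₙ`:
regularity, the Neumann condition in quantitative form, and frames in which the modified Hessian
is minimal at a given point. -/
structure HalfSpaceControl {n : ℕ} (ψ : Eu n → ℝ) (ln : Fin n) (b lam Lam L : ℝ) : Prop where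
  contDiffAt : ∀ x : Eu n, 0 < x ln → ContDiffAt ℝ 2 ψ x
  abs_pd_le : ∀ x : Eu n, 0 < x ln → |pd ψ ln x| ≤ L * x ln
  abs_pd_sub_le : ∀ x y : Eu n, 0 < x ln → 0 < y ln →
    |pd ψ ln x - pd ψ ln y| ≤ L * ‖x - y‖
  frame : ∀ x : Eu n, 0 < x ln → ∃ V : Fin n → Eu n,
    (∀ z, lam * ‖z‖ ^ 2 ≤ ∑ k, inner ℝ (V k) z ^ 2) ∧
    (∀ z, ∑ k, inner ℝ (V k) z ^ 2 ≤ Lam * ‖z‖ ^ 2) ∧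
    ∀ y : Eu n, 0 < y ln → 0 ≤ ∑ k, (bHess b ψ ln y (V k) - bHess b ψ ln x (V k))

/-- The difference quotient of `ψ` in the last direction, compared with an exponential barrier. -/
def barrierDiff {n : ℕ} (ψ : Eu n → ℝ) (ln : Fin n) (ε h m σ γ ε₀ R d : ℝ) (x : Eu n) : ℝ :=
  ε * ((ψ (x + h • EuclideanSpace.single ln (1 : ℝ)) - ψ x) / h) - m * x ln +
    σ * (x ln * (Real.exp (-γ * anisoSq ln ε₀ R x) - d))

variable {n : ℕ} {ψ : Eu n → ℝ} {ln : Fin n} {ε h m σ γ ε₀ R d b lam Lam L : ℝ}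

lemma exists_pd_eq_diffQuot (hψ : ∀ x : Eu n, 0 < x ln → DifferentiableAt ℝ ψ x) {x : Eu n}
    (hx : 0 < x ln) (hh : 0 < h) : ∃ ξ ∈ Ioo 0 h,
      (ψ (x + h • EuclideanSpace.single ln (1 : ℝ)) - ψ x) / h =
        pd ψ ln (x + ξ • EuclideanSpace.single ln (1 : ℝ)) := by
  have hd : ∀ s : ℝ, 0 ≤ s → HasDerivAt
      (fun s : ℝ => ψ (x + s • EuclideanSpace.single ln (1 : ℝ)))
      (pd ψ ln (x + s • EuclideanSpace.single ln (1 : ℝ))) s := fun s hs =>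
    (hψ _ (by simp; linarith)).hasFDerivAt.comp_hasDerivAt s (hasDerivAt_line x _ s)
  obtain ⟨ξ, hξ, hξe⟩ := exists_hasDerivAt_eq_slope _ _ hh
    (fun s hs => (hd s hs.1).continuousAt.continuousWithinAt) (fun s hs => hd s hs.1.le)
  exact ⟨ξ, hξ, by simpa using hξe.symm⟩

lemma IsLocalMax.barrierDiff_first_order {y : Eu n}
    (hy : IsLocalMax (barrierDiff ψ ln ε h m σ γ ε₀ R d) y)
    (h0 : DifferentiableAt ℝ ψ y)
    (h1 : DifferentiableAt ℝ ψ (y + h • EuclideanSpace.single ln (1 : ℝ))) :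
    ε * ((pd ψ ln (y + h • EuclideanSpace.single ln (1 : ℝ)) - pd ψ ln y) / h) =
      m - σ * (Real.exp (-γ * anisoSq ln ε₀ R y) - d) +
      2 * γ * σ * y ln * (y ln - R) * Real.exp (-γ * anisoSq ln ε₀ R y) := by
  set e : Eu n := EuclideanSpace.single ln (1 : ℝ) with he
  have hye : inner ℝ y e = y ln := inner_single_one y
  have hee : e ln = 1 := by simp [he]
  have hr1 : anisoLin ln ε₀ R y e = y ln - R := by
    rw [anisoLin, hye, hee]; ring
  have hd0 : HasDerivAt (fun s : ℝ => ψ (y + s • e)) (pd ψ ln y) 0 := by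
    have : HasFDerivAt ψ (fderiv ℝ ψ y) (y + (0 : ℝ) • e) := by simpa using h0.hasFDerivAt
    exact this.comp_hasDerivAt 0 (hasDerivAt_line y e 0)
  have hd1 : HasDerivAt (fun s : ℝ => ψ (y + h • e + s • e)) (pd ψ ln (y + h • e)) 0 := by
    have : HasFDerivAt ψ (fderiv ℝ ψ (y + h • e)) (y + h • e + (0 : ℝ) • e) := by
      simpa using h1.hasFDerivAt
    exact this.comp_hasDerivAt 0 (hasDerivAt_line (y + h • e) e 0)
  have hd2 := hasDerivAt_linear_mul_exp (y ln) 1 d γ (anisoSq ln ε₀ R y) (anisoLin ln ε₀ R y e)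
    (anisoSq ln ε₀ 0 e) 0
  have hd3 : HasDerivAt (fun s : ℝ => m * (y ln + 1 * s)) m 0 := by
    simpa using (((hasDerivAt_id (0 : ℝ)).const_mul 1).const_add (y ln)).const_mul m
  have hd := ((((hd1.fun_sub hd0).div_const h).const_mul ε).fun_sub hd3).fun_add (hd2.const_mul σ)
  have heq : ∀ s : ℝ, barrierDiff ψ ln ε h m σ γ ε₀ R d (y + s • e) =
      ε * ((ψ (y + h • e + s • e) - ψ (y + s • e)) / h) - m * (y ln + 1 * s) +
      σ * ((y ln + 1 * s) * (Real.exp (-γ * (anisoSq ln ε₀ R y +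
        2 * anisoLin ln ε₀ R y e * s + anisoSq ln ε₀ 0 e * s ^ 2)) - d)) := fun s => by
    rw [barrierDiff, anisoSq_line, add_right_comm, ← he]
    simp [hee]
  have hmax : IsLocalMax (fun s : ℝ => barrierDiff ψ ln ε h m σ γ ε₀ R d (y + s • e)) 0 := by
    have hc : ContinuousAt (fun s : ℝ => y + s • e) 0 := by fun_prop
    refine IsMaxFilter.comp_tendsto (f := barrierDiff ψ ln ε h m σ γ ε₀ R d)
      (g := fun s : ℝ => y + s • e) (l := 𝓝 y) (b := (0 : ℝ)) ?_ ?_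
    · rw [zero_smul, add_zero]
      exact hy
    · simpa [ContinuousAt] using hc
  rw [funext heq] at hmax
  have := hmax.hasDerivAt_eq_zero hd
  rw [hr1] at this
  simp only [mul_zero, add_zero, ne_eq, OfNat.ofNat_ne_zero, not_false_eq_true,
    zero_pow] at this
  linear_combination this

lemma IsLocalMax.barrierDiff_second_order {y : Eu n}
    (hy : IsLocalMax (barrierDiff ψ ln ε h m σ γ ε₀ R d) y)
    (h0 : ContDiffAt ℝ 2 ψ y)
    (h1 : ContDiffAt ℝ 2 ψ (y + h • EuclideanSpace.single ln (1 : ℝ))) (V : Eu n) :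
    ε * ((hessQuad ψ (y + h • EuclideanSpace.single ln (1 : ℝ)) V - hessQuad ψ y V) / h) +
      σ * (Real.exp (-γ * anisoSq ln ε₀ R y) *
        (y ln * (4 * γ ^ 2 * anisoLin ln ε₀ R y V ^ 2 - 2 * γ * anisoSq ln ε₀ 0 V) -
          4 * γ * V ln * anisoLin ln ε₀ R y V)) ≤ 0 := by
  set e : Eu n := EuclideanSpace.single ln (1 : ℝ) with he
  refine hy.secondDiff_limit_nonpos (v := V) ?_
  have hl := ((((tendsto_secondDiff h1 V).sub (tendsto_secondDiff h0 V)).div_const h).const_mul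
    ε).add ((tendsto_second_quotient_mul_exp (y ln) (V ln) d γ (anisoSq ln ε₀ R y)
      (anisoLin ln ε₀ R y V) (anisoSq ln ε₀ 0 V)).const_mul σ)
  refine hl.congr fun s => ?_
  have h3 := anisoSq_line (ln := ln) (ε₀ := ε₀) (R := R) y V s
  have h4 := anisoSq_line (ln := ln) (ε₀ := ε₀) (R := R) y V (-s)
  rw [neg_smul, ← sub_eq_add_neg] at h4
  have h5 : y + s • V + h • e = y + h • e + s • V := by abel
  have h6 : y - s • V + h • e = y + h • e - s • V := by abel
  simp only [secondDiff, barrierDiff, ← he, h3, h4, h5, h6, PiLp.add_apply, PiLp.sub_apply,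
    PiLp.smul_apply, smul_eq_mul]
  ring

namespace HalfSpaceControl

lemma abs_diffQuot_sub_le (H : HalfSpaceControl ψ ln b lam Lam L) (hL : 0 ≤ L) {x : Eu n}
    (hx : 0 < x ln) (hh : 0 < h) {t : ℝ} (ht : t ∈ Icc 0 h) :
    |(ψ (x + h • EuclideanSpace.single ln (1 : ℝ)) - ψ x) / h -
      pd ψ ln (x + t • EuclideanSpace.single ln (1 : ℝ))| ≤ L * h := by
  obtain ⟨ξ, hξ, he⟩ := exists_pd_eq_diffQuot (ψ := ψ)
    (fun x hx => (H.contDiffAt x hx).differentiableAt (by simp)) hx hh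
  rw [he]
  refine (H.abs_pd_sub_le _ _ (by simp; linarith [hξ.1]) (by simp; linarith [ht.1])).trans ?_
  gcongr
  rw [add_sub_add_left_eq_sub, ← sub_smul, norm_smul]
  simp only [PiLp.norm_single, norm_one, mul_one, Real.norm_eq_abs, abs_le]
  constructor <;> linarith [hξ.1, hξ.2, ht.1, ht.2]

lemma barrierDiff_nonpos_of_isLocalMax (H : HalfSpaceControl ψ ln b lam Lam L) {η δ : ℝ}
    (hlam : 0 < lam) (hlL : lam ≤ Lam) (hb : 0 ≤ b) (hL : 0 ≤ L)
    (hε : ε = 1 ∨ ε = -1) (hσ : 0 < σ) (hR : 0 < R) (hγ : 0 < γ)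
    (hε₀ : ε₀ = (lam / (2 * Lam)) ^ 2)
    (hα : (n + b + 2) * Lam ≤ 2 * γ * R ^ 2 * lam * ε₀ * η ^ 2)
    (hh : 0 < h) (hδ : 2 * (L * h) ≤ δ) {y : Eu n} (hy : 0 < y ln)
    (hy1 : η ^ 2 * R ^ 2 ≤ anisoSq ln ε₀ R y) (hy2 : anisoSq ln ε₀ R y ≤ 2 * R ^ 2)
    (hM : m - σ * (Real.exp (-γ * anisoSq ln ε₀ R y) - d) ≤ L)
    (hmax : IsLocalMax (barrierDiff ψ ln ε h m σ γ ε₀ R d) y) :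
    barrierDiff ψ ln ε h m σ γ ε₀ R d y ≤ δ := by
  by_contra! hZ
  have hquot := H.abs_diffQuot_sub_le hL hy hh (right_mem_Icc.2 hh.le)
  set e : Eu n := EuclideanSpace.single ln (1 : ℝ) with he
  set y1 : Eu n := y + h • e with hy1d
  have hy1n : y1 ln = y ln + h := by simp [hy1d, he]
  have hy10 : 0 < y1 ln := by rw [hy1n]; linarith
  have hfirst := hmax.barrierDiff_first_order
    ((H.contDiffAt y hy).differentiableAt (by simp))
    ((H.contDiffAt y1 hy10).differentiableAt (by simp))
  have hsecond := hmax.barrierDiff_second_order (H.contDiffAt y hy) (H.contDiffAt y1 hy10)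
  rw [← he, ← hy1d] at hfirst
  simp only [← he, ← hy1d] at hsecond
  rw [barrierDiff, ← he, ← hy1d] at hZ
  have hB0 : 0 < Real.exp (-γ * anisoSq ln ε₀ R y) := Real.exp_pos _
  generalize Real.exp (-γ * anisoSq ln ε₀ R y) = B at *
  set g := pd ψ ln y with hg
  set g1 := pd ψ ln y1 with hg1
  have hΘ : ε * ((g1 / y1 ln - g / y ln) / h) ≤ 2 * γ * σ * (y ln - R) * B := by
    have h2 : ε * g1 ≥ ε * ((ψ y1 - ψ y) / h) - L * h := by
      have := abs_le.1 hquot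
      rcases hε with rfl | rfl <;> linarith [this.1, this.2]
    have h3 : (m - σ * (B - d)) * (y ln + h) ≤ ε * g1 := by
      have := mul_le_mul_of_nonneg_right hM hh.le
      linarith
    have h4 : ε * ((g1 / y1 ln - g / y ln) / h) =
        (ε * ((g1 - g) / h) - ε * g1 / (y ln + h)) / y ln := by
      rw [hy1n]; field_simp; ring
    have h5 : m - σ * (B - d) ≤ ε * g1 / (y ln + h) := by
      rwa [le_div_iff₀ (by linarith)]
    rw [h4, hfirst, div_le_iff₀ hy]
    linarith
  obtain ⟨V, hV1, hV2, hV3⟩ : ∃ V : Fin n → Eu n,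
      (∀ z, lam * ‖z‖ ^ 2 ≤ ∑ k, inner ℝ (V k) z ^ 2) ∧
      (∀ z, ∑ k, inner ℝ (V k) z ^ 2 ≤ Lam * ‖z‖ ^ 2) ∧
      0 ≤ ε * ∑ k, (bHess b ψ ln y1 (V k) - bHess b ψ ln y (V k)) := by
    rcases hε with rfl | rfl
    · obtain ⟨V, hV1, hV2, hV3⟩ := H.frame y hy
      exact ⟨V, hV1, hV2, by simpa using hV3 y1 hy10⟩
    · obtain ⟨V, hV1, hV2, hV3⟩ := H.frame y1 hy10
      refine ⟨V, hV1, hV2, ?_⟩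
      have := hV3 y hy
      rw [Finset.sum_sub_distrib] at this ⊢
      linarith
  have hcore := barrier_core hlam hlL hb hR hγ hε₀ hα hy hy1 hy2 hV1 hV2
  have hsum := Finset.sum_nonpos fun k (_ : k ∈ Finset.univ) => hsecond (V k)
  have hsum' : ε * ((∑ k, (hessQuad ψ y1 (V k) - hessQuad ψ y (V k))) / h) +
      2 * γ * σ * B * (y ln * (2 * γ * ∑ k, anisoLin ln ε₀ R y (V k) ^ 2 -
        ∑ k, anisoSq ln ε₀ 0 (V k)) - 2 * ∑ k, V k ln * anisoLin ln ε₀ R y (V k)) ≤ 0 := by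
    refine le_of_eq_of_le ?_ hsum
    simp only [Finset.sum_div, Finset.mul_sum, ← Finset.sum_sub_distrib, ← Finset.sum_add_distrib]
    exact Finset.sum_congr rfl fun k _ => by ring
  have hframe : 0 ≤ ε * ((∑ k, (hessQuad ψ y1 (V k) - hessQuad ψ y (V k))) / h) +
      b * (ε * ((g1 / y1 ln - g / y ln) / h)) * ∑ k, V k ln ^ 2 := by
    refine (div_nonneg hV3 hh.le).trans_eq ?_
    have : ∑ k, (bHess b ψ ln y1 (V k) - bHess b ψ ln y (V k)) =
        ∑ k, (hessQuad ψ y1 (V k) - hessQuad ψ y (V k)) +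
        b * (g1 / y1 ln - g / y ln) * ∑ k, V k ln ^ 2 := by
      rw [Finset.mul_sum, ← Finset.sum_add_distrib]
      exact Finset.sum_congr rfl fun k _ => by simp only [bHess, ← hg, ← hg1]; ring
    rw [this]
    ring
  have hS : 0 ≤ ∑ k, V k ln ^ 2 := Finset.sum_nonneg fun _ _ => sq_nonneg _
  have hfr2 := mul_le_mul_of_nonneg_right (mul_le_mul_of_nonneg_left hΘ hb) hS
  have hpos : 0 < 2 * γ * σ * B := by positivity
  have := mul_pos hpos hcore
  linarith

end HalfSpaceControl
end HalfSpace

section HalfSpace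

open Filter Topology Set Metric

variable {n : ℕ} {ψ : Eu n → ℝ} {ln : Fin n} {ε m σ γ ε₀ R b lam Lam L : ℝ}

lemma anisoSq_nonneg (h : 0 ≤ ε₀) (x : Eu n) : 0 ≤ anisoSq ln ε₀ R x := by
  rw [anisoSq_eq]; positivity

lemma isCompact_anisoSq_le (h : 0 < ε₀) (c δ₀ : ℝ) :
    IsCompact {x : Eu n | δ₀ ≤ x ln ∧ anisoSq ln ε₀ R x ≤ c} := by
  refine isCompact_of_isClosed_isBounded ?_ ?_
  · exact (isClosed_le continuous_const (by fun_prop : Continuous fun x : Eu n => x ln)).inter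
      (isClosed_le continuous_anisoSq continuous_const)
  · refine (isBounded_closedBall (x := (0 : Eu n)) (r := √(c / ε₀ + 2 * c + 2 * R ^ 2))).subset ?_
    rintro x ⟨-, hx⟩
    rw [mem_closedBall, dist_zero_right]
    refine Real.le_sqrt_of_sq_le ?_
    rw [anisoSq] at hx
    have h1 := coord_sq_le_norm_sq (ln := ln) x
    have h2 : ‖x‖ ^ 2 - x ln ^ 2 ≤ c / ε₀ := by
      rw [le_div_iff₀ h]
      linarith [sq_nonneg (x ln - R)]
    have h3 : 0 ≤ ε₀ * (‖x‖ ^ 2 - x ln ^ 2) := mul_nonneg h.le (by linarith)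
    linarith [sq_nonneg (x ln - 2 * R)]

namespace HalfSpaceControl

/-- A one-sided bound for `∂ψ/∂xₙ / xₙ` that improves by `σ` near the point of height `R` improves
on a whole half-ball-like region touching the boundary. -/
lemma pd_le_sub_barrier (H : HalfSpaceControl ψ ln b lam Lam L) {η : ℝ}
    (hlam : 0 < lam) (hlL : lam ≤ Lam) (hb : 0 ≤ b) (hL : 0 ≤ L)
    (hε : ε = 1 ∨ ε = -1) (hσ : 0 < σ) (hR : 0 < R) (hγ : 0 < γ)
    (hε₀ : ε₀ = (lam / (2 * Lam)) ^ 2)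
    (hα : (n + b + 2) * Lam ≤ 2 * γ * R ^ 2 * lam * ε₀ * η ^ 2) (hmL : m ≤ L)
    (hm : ∀ x : Eu n, 0 < x ln → ε * pd ψ ln x ≤ m * x ln)
    (hin : ∀ x : Eu n, 0 < x ln → anisoSq ln ε₀ R x ≤ η ^ 2 * R ^ 2 →
      ε * pd ψ ln x ≤ (m - σ) * x ln) {x : Eu n} (hx : 0 < x ln)
    (hxR : anisoSq ln ε₀ R x ≤ 2 * R ^ 2) :
    ε * pd ψ ln x ≤ x ln *
      (m - σ * (Real.exp (-γ * anisoSq ln ε₀ R x) - Real.exp (-γ * (2 * R ^ 2)))) := by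
  have hLam : 0 < Lam := hlam.trans_le hlL
  have hε0 : 0 < ε₀ := by rw [hε₀]; positivity
  set d := Real.exp (-γ * (2 * R ^ 2)) with hd
  have hd0 : 0 < d := Real.exp_pos _
  have hB1 : ∀ x : Eu n, Real.exp (-γ * anisoSq ln ε₀ R x) ≤ 1 := fun x => by
    have := mul_nonneg hγ.le (anisoSq_nonneg (ln := ln) (R := R) hε0.le x)
    exact Real.exp_le_one_iff.2 (by linarith)
  refine le_of_forall_pos_le_add fun δ' hδ' => ?_
  obtain ⟨δ, hδ, rfl⟩ : ∃ δ, 0 < δ ∧ δ' = 2 * δ := ⟨δ' / 2, by linarith, by ring⟩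
  obtain ⟨h, hh, hLh⟩ : ∃ h, 0 < h ∧ 3 * (L * h) < δ := by
    refine ⟨δ / (3 * L + 1), by positivity, ?_⟩
    have : 3 * (L * (δ / (3 * L + 1))) = 3 * L * δ / (3 * L + 1) := by ring
    rw [this, div_lt_iff₀ (by positivity)]
    linarith
  have hLh0 : 0 ≤ L * h := by positivity
  set Z := barrierDiff ψ ln ε h m σ γ ε₀ R d with hZ
  have hquot : ∀ x : Eu n, 0 < x ln →
      |ε * ((ψ (x + h • EuclideanSpace.single ln (1 : ℝ)) - ψ x) / h) - ε * pd ψ ln x| ≤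
        L * h := fun x hx => by
    have := H.abs_diffQuot_sub_le hL hx hh (left_mem_Icc.2 hh.le)
    rw [zero_smul, add_zero] at this
    rw [← mul_sub, abs_mul]
    rcases hε with rfl | rfl <;> simpa using this
  have hZle : ∀ x : Eu n, 0 < x ln → Z x ≤ ε * pd ψ ln x + L * h - m * x ln +
      σ * (x ln * (Real.exp (-γ * anisoSq ln ε₀ R x) - d)) := fun x hx => by
    rw [hZ, barrierDiff]
    linarith [(abs_le.1 (hquot x hx)).2]
  have hlow : ∀ x : Eu n, 0 < x ln → x ln ≤ δ / (2 * σ) → Z x ≤ δ := fun x hx hxδ => by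
    refine (hZle x hx).trans ?_
    rw [le_div_iff₀ (by positivity)] at hxδ
    have h1 : σ * (x ln * (Real.exp (-γ * anisoSq ln ε₀ R x) - d)) ≤ σ * (x ln * 1) := by
      gcongr
      linarith [hB1 x]
    linarith [hm x hx]
  have htop : ∀ x : Eu n, 0 < x ln → anisoSq ln ε₀ R x = 2 * R ^ 2 → Z x ≤ δ :=
    fun x hx hxR => by
    refine (hZle x hx).trans ?_
    rw [hxR, ← hd]
    linarith [hm x hx]
  have hinZ : ∀ x : Eu n, 0 < x ln → anisoSq ln ε₀ R x ≤ η ^ 2 * R ^ 2 → Z x ≤ δ :=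
    fun x hx hxR => by
    refine (hZle x hx).trans ?_
    have h1 : σ * (x ln * (Real.exp (-γ * anisoSq ln ε₀ R x) - d)) ≤ σ * (x ln * 1) := by
      gcongr
      linarith [hB1 x]
    linarith [hin x hx hxR]
  have hZx : Z x ≤ δ := by
    rcases le_or_gt (x ln) (δ / (2 * σ)) with hxδ | hxδ
    · exact hlow x hx hxδ
    have hδ₀ : 0 < δ / (2 * σ) := by positivity
    have hcont : ContinuousOn Z
        {x : Eu n | δ / (2 * σ) ≤ x ln ∧ anisoSq ln ε₀ R x ≤ 2 * R ^ 2} := by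
      intro z hz
      have hz0 : 0 < z ln := hδ₀.trans_le hz.1
      have hc1 : ContinuousAt ψ z := (H.contDiffAt z hz0).continuousAt
      have hc2 : ContinuousAt (fun z : Eu n => ψ (z + h • EuclideanSpace.single ln (1 : ℝ))) z :=
        ContinuousAt.comp (g := ψ) (f := fun z : Eu n => z + h • EuclideanSpace.single ln (1 : ℝ))
          (H.contDiffAt _ (by simp; linarith)).continuousAt (by fun_prop)
      have hc3 := (continuous_anisoSq (ln := ln) (ε₀ := ε₀) (R := R)).continuousAt (x := z)
      refine ContinuousAt.continuousWithinAt ?_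
      have hc4 : ContinuousAt (fun z : Eu n => z ln) z := by fun_prop
      exact ((((hc2.sub hc1).div_const h).const_mul ε).sub (hc4.const_mul m)).add
        ((hc4.mul (((hc3.const_mul (-γ)).rexp).sub continuousAt_const)).const_mul σ)
    obtain ⟨y, hy, hymax⟩ := (isCompact_anisoSq_le hε0 _ _).exists_isMaxOn
      ⟨x, hxδ.le, hxR⟩ hcont
    refine (hymax ⟨hxδ.le, hxR⟩).trans ?_
    by_contra! hcon
    have hy0 : 0 < y ln := hδ₀.trans_le hy.1
    have hyδ : δ / (2 * σ) < y ln := lt_of_not_ge fun hle => absurd (hlow y hy0 hle) hcon.not_ge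
    have hyR : anisoSq ln ε₀ R y < 2 * R ^ 2 :=
      lt_of_le_of_ne hy.2 fun he => absurd (htop y hy0 he) hcon.not_ge
    have hyη : η ^ 2 * R ^ 2 ≤ anisoSq ln ε₀ R y :=
      le_of_not_ge fun hle => absurd (hinZ y hy0 hle) hcon.not_ge
    have hloc : IsLocalMax Z y := by
      refine hymax.isLocalMax ?_
      have h1 : Continuous fun z : Eu n => z ln := by fun_prop
      filter_upwards [(isOpen_lt continuous_const h1).mem_nhds hyδ,
        (isOpen_lt (continuous_anisoSq (ln := ln) (ε₀ := ε₀) (R := R))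
          continuous_const).mem_nhds hyR] with z hz1 hz2
      exact ⟨le_of_lt hz1, le_of_lt hz2⟩
    have hdB : d ≤ Real.exp (-γ * anisoSq ln ε₀ R y) := by
      rw [hd]
      refine Real.exp_le_exp.2 ?_
      have := mul_le_mul_of_nonneg_left hy.2 hγ.le
      linarith
    refine hcon.not_ge (H.barrierDiff_nonpos_of_isLocalMax hlam hlL hb hL hε hσ hR hγ hε₀ hα hh
      (by linarith) hy0 hyη hy.2 ?_ hloc)
    have := mul_nonneg hσ.le (sub_nonneg.2 hdB)
    linarith
  rw [hZ, barrierDiff] at hZx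
  linarith [(abs_le.1 (hquot x hx)).1]

end HalfSpaceControl
end HalfSpace

section HalfSpace

open Filter Topology Set Metric

variable {n : ℕ} {ψ : Eu n → ℝ} {ln : Fin n} {b lam Lam L : ℝ}

namespace HalfSpaceControl

lemma abs_pd_sub_mul_le (H : HalfSpaceControl ψ ln b lam Lam L) (hL : 0 ≤ L) {τ η ω R : ℝ}
    (hτ0 : 0 < τ) (hτ1 : τ ≤ 1) (hη0 : 0 < η) (hη1 : η ≤ 1 / 2) (hηω : 16 * L * η ≤ ω * τ)
    (hR : 0 < R) {x : Eu n} (hx : 0 < x ln) (hxR : anisoSq ln (τ ^ 2) R x ≤ η ^ 2 * R ^ 2) :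
    |pd ψ ln x - pd ψ ln (R • EuclideanSpace.single ln (1 : ℝ)) / R * x ln| ≤ ω / 4 * x ln := by
  set e : Eu n := EuclideanSpace.single ln (1 : ℝ) with he
  have hen : (R • e) ln = R := by simp [he]
  have he1 : ‖e‖ = 1 := by simp [he]
  set D := ‖x - R • e‖ with hD
  have hD2 : D ^ 2 = (‖x‖ ^ 2 - x ln ^ 2) + (x ln - R) ^ 2 := by
    rw [hD, norm_sub_sq_real, inner_smul_right, inner_single_one, norm_smul, he1, mul_one,
      Real.norm_eq_abs, sq_abs]
    ring
  have hx2 := coord_sq_le_norm_sq (ln := ln) x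
  rw [anisoSq] at hxR
  have hηR : 0 < η * R := by positivity
  have h1 : |x ln - R| ≤ η * R := by
    refine abs_le_of_sq_le_sq ?_ hηR.le
    have : 0 ≤ τ ^ 2 * (‖x‖ ^ 2 - x ln ^ 2) := mul_nonneg (sq_nonneg _) (by linarith)
    rw [mul_pow]
    linarith
  have h2 : R / 2 ≤ x ln := by
    have := (abs_le.1 h1).1
    have : η * R ≤ 1 / 2 * R := by gcongr
    linarith
  have h3 : |x ln - R| ≤ D := by
    refine abs_le_of_sq_le_sq ?_ (norm_nonneg _)
    linarith
  have h4 : τ * D ≤ η * R := by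
    refine le_of_sq_le_sq ?_ hηR.le
    rw [mul_pow, mul_pow, hD2, mul_add]
    have : τ ^ 2 * (x ln - R) ^ 2 ≤ 1 * (x ln - R) ^ 2 := by
      gcongr
      exact pow_le_one₀ hτ0.le hτ1
    linarith
  have h5 : |pd ψ ln x - pd ψ ln (R • e)| ≤ L * D :=
    H.abs_pd_sub_le x (R • e) hx (by rw [hen]; exact hR)
  have h6 : |pd ψ ln (R • e) / R| ≤ L := by
    rw [abs_div, abs_of_pos hR, div_le_iff₀ hR]
    simpa only [hen] using H.abs_pd_le (R • e) (by rw [hen]; exact hR)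
  have h7 : pd ψ ln x - pd ψ ln (R • e) / R * x ln =
      (pd ψ ln x - pd ψ ln (R • e)) - pd ψ ln (R • e) / R * (x ln - R) := by
    field_simp
    ring
  have h8 : |pd ψ ln (R • e) / R * (x ln - R)| ≤ L * D := by
    rw [abs_mul]
    gcongr
  have h9 : 2 * (L * D) ≤ ω / 4 * x ln := by
    have h10 : 2 * L * (τ * D) ≤ 2 * L * (η * (2 * x ln)) := by
      refine mul_le_mul_of_nonneg_left (h4.trans ?_) (by positivity)
      gcongr
      linarith
    have h11 := mul_le_mul_of_nonneg_right hηω hx.le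
    have h12 : τ * (2 * (L * D)) ≤ τ * (ω / 4 * x ln) := by linarith
    exact le_of_mul_le_mul_left h12 hτ0
  rw [h7]
  exact (abs_sub _ _).trans (by linarith)

lemma exists_oscillation_decay (H : HalfSpaceControl ψ ln b lam Lam L)
    (hlam : 0 < lam) (hlL : lam ≤ Lam) (hb : 0 ≤ b) (hL : 0 ≤ L) {M : ℝ → ℝ}
    (hML : ∀ ε, ε = 1 ∨ ε = -1 → M ε ≤ L)
    (hM : ∀ ε, ε = 1 ∨ ε = -1 → ∀ x : Eu n, 0 < x ln → ε * pd ψ ln x ≤ M ε * x ln)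
    (hω : 0 < M 1 + M (-1)) :
    ∃ κ, 0 < κ ∧ ∀ R, 0 < R → ∃ ε, (ε = 1 ∨ ε = -1) ∧ ∀ x : Eu n, 0 < x ln →
      ‖x‖ ^ 2 ≤ R ^ 2 / 2 → ε * pd ψ ln x ≤ (M ε - κ) * x ln := by
  have hLam : 0 < Lam := hlam.trans_le hlL
  set ω := M 1 + M (-1) with hωd
  set τ := lam / (2 * Lam) with hτ
  have hτ0 : 0 < τ := by positivity
  have hτ1 : τ ≤ 1 := by
    rw [hτ, div_le_one (by positivity)]
    linarith
  set η := min (1 / 2) (ω * τ / (16 * L + 1)) with hη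
  have hη0 : 0 < η := lt_min (by norm_num) (by positivity)
  have hη1 : η ≤ 1 / 2 := min_le_left _ _
  have hηω : 16 * L * η ≤ ω * τ := by
    have : η ≤ ω * τ / (16 * L + 1) := min_le_right _ _
    rw [le_div_iff₀ (by positivity)] at this
    linarith
  set α := (n + b + 2) * Lam / (2 * lam * τ ^ 2 * η ^ 2) with hα
  have hα0 : 0 < α := by positivity
  have hαe : (n + b + 2) * Lam = 2 * α * lam * τ ^ 2 * η ^ 2 := by
    rw [hα]; field_simp
  refine ⟨ω / 4 * (Real.exp (-(3 / 2 * α)) - Real.exp (-(2 * α))), ?_, fun R hR => ?_⟩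
  · refine mul_pos (by positivity) (sub_pos.2 (Real.exp_lt_exp.2 ?_))
    linarith
  set t := pd ψ ln (R • EuclideanSpace.single ln (1 : ℝ)) / R with ht
  obtain ⟨ε, hε, hεt⟩ : ∃ ε, (ε = 1 ∨ ε = -1) ∧ ε * t ≤ M ε - ω / 2 := by
    by_contra! hcon
    have h1 := hcon 1 (Or.inl rfl)
    have h2 := hcon (-1) (Or.inr rfl)
    linarith
  refine ⟨ε, hε, fun x hx hxR => ?_⟩
  have hγR : α / R ^ 2 * R ^ 2 = α := by field_simp
  have hγ0 : 0 < α / R ^ 2 := by positivity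
  have hx1 : anisoSq ln (τ ^ 2) R x ≤ 3 / 2 * R ^ 2 := by
    have h1 : τ ^ 2 * (‖x‖ ^ 2 - x ln ^ 2) ≤ 1 * (‖x‖ ^ 2 - x ln ^ 2) :=
      mul_le_mul_of_nonneg_right (pow_le_one₀ hτ0.le hτ1)
        (sub_nonneg.2 (coord_sq_le_norm_sq x))
    have h2 : 0 < x ln * R := by positivity
    rw [anisoSq]
    linarith
  have hbar := H.pd_le_sub_barrier (m := M ε) (σ := ω / 4) (η := η) (γ := α / R ^ 2)
    hlam hlL hb hL hε (by positivity)
    hR hγ0 rfl (by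
      have : 2 * (α / R ^ 2) * R ^ 2 = 2 * α := by rw [mul_assoc, hγR]
      rw [this, hαe]) (hML ε hε) (hM ε hε) (fun z hz hzR => ?_) hx (by linarith [sq_nonneg R])
  · refine hbar.trans ?_
    rw [mul_comm]
    gcongr
    · have := mul_le_mul_of_nonneg_left hx1 hγ0.le
      linarith
    · linarith
  · have h1 := abs_le.1 (H.abs_pd_sub_mul_le hL hτ0 hτ1 hη0 hη1 hηω hR hz hzR)
    rw [← ht] at h1
    have h2 := mul_le_mul_of_nonneg_right hεt hz.le
    rcases hε with rfl | rfl <;> linarith [h1.1, h1.2]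

/-- Rigidity of the Neumann quotient: `∂ψ/∂xₙ` is a constant multiple of `xₙ`. -/
lemma exists_pd_eq (H : HalfSpaceControl ψ ln b lam Lam L)
    (hlam : 0 < lam) (hlL : lam ≤ Lam) (hb : 0 ≤ b) (hL : 0 ≤ L) :
    ∃ a : ℝ, ∀ x : Eu n, 0 < x ln → pd ψ ln x = a * x ln := by
  set S : ℝ → Set ℝ := fun ε => (fun x : Eu n => ε * pd ψ ln x / x ln) '' {x | 0 < x ln} with hS
  have hSle : ∀ ε, ε = 1 ∨ ε = -1 → L ∈ upperBounds (S ε) := by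
    rintro ε hε _ ⟨x, hx, rfl⟩
    simp only
    rw [div_le_iff₀ hx]
    have := abs_le.1 (H.abs_pd_le x hx)
    rcases hε with rfl | rfl <;> linarith [this.1, this.2]
  have hne : ∀ ε, (S ε).Nonempty := fun ε =>
    ⟨_, EuclideanSpace.single ln (1 : ℝ), by simp, rfl⟩
  set M : ℝ → ℝ := fun ε => sSup (S ε) with hMd
  have hML : ∀ ε, ε = 1 ∨ ε = -1 → M ε ≤ L := fun ε hε => csSup_le (hne ε) (hSle ε hε)
  have hM : ∀ ε, ε = 1 ∨ ε = -1 → ∀ x : Eu n, 0 < x ln → ε * pd ψ ln x ≤ M ε * x ln :=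
    fun ε hε x hx => by
      rw [← div_le_iff₀ hx]
      exact le_csSup ⟨L, hSle ε hε⟩ ⟨x, hx, rfl⟩
  rcases le_or_gt (M 1 + M (-1)) 0 with hω | hω
  · refine ⟨M 1, fun x hx => ?_⟩
    have h1 := hM 1 (Or.inl rfl) x hx
    have h2 := hM (-1) (Or.inr rfl) x hx
    have h3 := mul_nonpos_of_nonpos_of_nonneg hω hx.le
    linarith
  · exfalso
    obtain ⟨κ, hκ, hκR⟩ := H.exists_oscillation_decay hlam hlL hb hL hML hM hω
    have hex : ∀ ε, ∃ x : Eu n, 0 < x ln ∧ (M ε - κ) * x ln < ε * pd ψ ln x := fun ε => by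
      obtain ⟨_, ⟨x, hx, rfl⟩, hlt⟩ := exists_lt_of_lt_csSup (hne ε) (sub_lt_self (M ε) hκ)
      exact ⟨x, hx, (lt_div_iff₀ hx).1 hlt⟩
    choose X hX hXlt using hex
    have hR0 : 0 < 2 * (‖X 1‖ + ‖X (-1)‖) + 1 := by positivity
    obtain ⟨ε, hε, hbad⟩ := hκR _ hR0
    refine (hXlt ε).not_ge (hbad _ (hX ε) ?_)
    have h1 : ‖X ε‖ ≤ ‖X 1‖ + ‖X (-1)‖ := by
      rcases hε with rfl | rfl
      · linarith [norm_nonneg (X (-1))]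
      · linarith [norm_nonneg (X 1)]
    have h2 : ‖X ε‖ ^ 2 ≤ (‖X 1‖ + ‖X (-1)‖) ^ 2 := by gcongr
    have h3 : 0 ≤ ‖X 1‖ + ‖X (-1)‖ := by positivity
    linarith [sq_nonneg (‖X 1‖ + ‖X (-1)‖)]

end HalfSpaceControl
end HalfSpace

section Ellipticity

open Filter Topology Set Metric Matrix

variable {n : ℕ} {ψ : Eu n → ℝ} {ln : Fin n} {b : ℝ}

lemma pd2_eq {x : Eu n} (hψ : ContDiffAt ℝ 2 ψ x) (i j : Fin n) :
    pd2 ψ i j x = fderiv ℝ (fderiv ℝ ψ) x (EuclideanSpace.single i 1)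
      (EuclideanSpace.single j 1) := by
  have h1 : DifferentiableAt ℝ (fderiv ℝ ψ) x :=
    (hψ.fderiv_right (m := 1) (by norm_num)).differentiableAt (by simp)
  have h2 := h1.hasFDerivAt.clm_apply (hasFDerivAt_const (EuclideanSpace.single j (1 : ℝ)) x)
  have h3 : fderiv ℝ (pd ψ j) x = _ := h2.fderiv
  rw [pd2, pd, h3]
  simp

lemma sum_smul_single (z : Eu n) : ∑ i, z i • EuclideanSpace.single i (1 : ℝ) = z := by
  simpa using (EuclideanSpace.basisFun (Fin n) ℝ).sum_repr z

lemma sum_mul_apply_single (B : Eu n →L[ℝ] Eu n →L[ℝ] ℝ) (z : Eu n) :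
    ∑ i, ∑ j, B (EuclideanSpace.single i 1) (EuclideanSpace.single j 1) * z i * z j = B z z := by
  conv_rhs => rw [← sum_smul_single z]
  simp only [map_sum, map_smul, _root_.sum_apply, _root_.smul_apply,
    smul_eq_mul]
  rw [Finset.sum_comm]
  refine Finset.sum_congr rfl fun i _ => ?_
  simp only [Finset.mul_sum]
  exact Finset.sum_congr rfl fun j _ => by ring

lemma dotProduct_Mb_mulVec {x : Eu n} (hψ : ContDiffAt ℝ 2 ψ x) (z : Fin n → ℝ) :
    z ⬝ᵥ Mb b ψ ln x *ᵥ z = bHess b ψ ln x (WithLp.toLp 2 z) := by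
  have h1 : ∀ i j, Mb b ψ ln x i j = fderiv ℝ (fderiv ℝ ψ) x (EuclideanSpace.single i 1)
      (EuclideanSpace.single j 1) + if i = ln ∧ j = ln then b * pd ψ ln x / x ln else 0 := by
    intro i j
    rw [Mb, Matrix.of_apply, ← pd2_eq hψ]
    split_ifs with h
    · rw [h.1, h.2]
    · rw [add_zero]
  have h2 : z ⬝ᵥ Mb b ψ ln x *ᵥ z = ∑ i, ∑ j, Mb b ψ ln x i j * z i * z j := by
    simp only [dotProduct, mulVec, Finset.mul_sum]
    exact Finset.sum_congr rfl fun i _ => Finset.sum_congr rfl fun j _ => by ring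
  rw [h2, bHess, hessQuad, ← sum_mul_apply_single]
  simp only [h1, add_mul, Finset.sum_add_distrib, ite_and, ite_mul, zero_mul]
  simp
  ring

lemma dotProduct_self_eq (z : Fin n → ℝ) : z ⬝ᵥ z = ‖(WithLp.toLp 2 z : Eu n)‖ ^ 2 := by
  rw [EuclideanSpace.norm_sq_eq]
  simp [dotProduct, pow_two]

lemma dotProduct_eq_inner (v z : Fin n → ℝ) :
    v ⬝ᵥ z = inner ℝ (WithLp.toLp 2 v : Eu n) (WithLp.toLp 2 z) := by
  simp [PiLp.inner_apply, dotProduct, mul_comm]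

lemma exists_bHess_frame (hψ : ∀ x : Eu n, 0 < x ln → ContDiffAt ℝ 2 ψ x)
    (heq : ∀ x : Eu n, 0 < x ln → (Mb b ψ ln x).det = 1) {C : ℝ} (hC : 0 < C)
    (hell : ∀ x : Eu n, 0 < x ln →
      matLE (C⁻¹ • (1 : Matrix (Fin n) (Fin n) ℝ)) (Mb b ψ ln x) ∧
      matLE (Mb b ψ ln x) (C • (1 : Matrix (Fin n) (Fin n) ℝ))) (x : Eu n) (hx : 0 < x ln) :
    ∃ V : Fin n → Eu n, (∀ z, C⁻¹ * ‖z‖ ^ 2 ≤ ∑ k, inner ℝ (V k) z ^ 2) ∧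
      (∀ z, ∑ k, inner ℝ (V k) z ^ 2 ≤ C * ‖z‖ ^ 2) ∧
      ∀ y : Eu n, 0 < y ln → ∀ z, (bHess b ψ ln y z - bHess b ψ ln x z) ^ 2 ≤
        (C ^ 2 * (1 + √(n * C ^ 2)) ^ 2) * ‖z‖ ^ 4 *
          ∑ k, (bHess b ψ ln y (V k) - bHess b ψ ln x (V k)) := by
  obtain ⟨V, hV1, hV2, hV3⟩ := exists_frame hC (hell x hx).1 (hell x hx).2 (heq x hx)
  refine ⟨fun k => WithLp.toLp 2 (V k), fun z => ?_, fun z => ?_, fun y hy z => ?_⟩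
  · have := hV1 z.ofLp
    simpa only [dotProduct_self_eq, dotProduct_eq_inner] using this
  · have := hV2 z.ofLp
    simpa only [dotProduct_self_eq, dotProduct_eq_inner] using this
  · have := hV3 _ (hell y hy).1 (hell y hy).2 (heq y hy) z.ofLp
    simp only [dotProduct_self_eq, dotProduct_Mb_mulVec (hψ x hx),
      dotProduct_Mb_mulVec (hψ y hy), ← pow_mul] at this
    exact this

lemma bHess_bounds {C : ℝ} {x : Eu n} (hψ : ContDiffAt ℝ 2 ψ x)
    (h1 : matLE (C⁻¹ • (1 : Matrix (Fin n) (Fin n) ℝ)) (Mb b ψ ln x))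
    (h2 : matLE (Mb b ψ ln x) (C • (1 : Matrix (Fin n) (Fin n) ℝ))) (z : Eu n) :
    C⁻¹ * ‖z‖ ^ 2 ≤ bHess b ψ ln x z ∧ bHess b ψ ln x z ≤ C * ‖z‖ ^ 2 := by
  have h3 := h1.quadForm_le z.ofLp
  have h4 := h2.quadForm_le z.ofLp
  simp only [smul_mulVec, one_mulVec, dotProduct_smul, smul_eq_mul, dotProduct_self_eq,
    dotProduct_Mb_mulVec hψ] at h3 h4
  exact ⟨h3, h4⟩

end Ellipticity

section Reduction

open Filter Topology Set Metric

/-- The translation along the last axis onto the hyperplane at height one. -/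
def toHeightOne {n : ℕ} (ln : Fin n) (x : Eu n) : Eu n :=
  x + (1 - x ln) • EuclideanSpace.single ln (1 : ℝ)

/-- A function on the whole space whose Hessian at `x` is the modified Hessian of `ψ` at the
point of height one above `x`. -/
def extendFromHeightOne {n : ℕ} (ψ : Eu n → ℝ) (ln : Fin n) (c : ℝ) (x : Eu n) : ℝ :=
  ψ (toHeightOne ln x) + c * x ln ^ 2

variable {n : ℕ} {ψ : Eu n → ℝ} {ln : Fin n} {a b : ℝ}

@[simp] lemma toHeightOne_apply (x : Eu n) : toHeightOne ln x ln = 1 := by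
  simp [toHeightOne]

lemma toHeightOne_toHeightOne_add (x z : Eu n) :
    toHeightOne ln (toHeightOne ln x + z) = toHeightOne ln (x + z) := by
  have : (1 - (toHeightOne ln x + z) ln) = -z ln := by
    rw [PiLp.add_apply, toHeightOne_apply]; ring
  rw [toHeightOne, this, toHeightOne, toHeightOne, PiLp.add_apply]
  module

lemma contDiff_toHeightOne : ContDiff ℝ 2 (toHeightOne ln) := by
  unfold toHeightOne
  have : ContDiff ℝ 2 fun x : Eu n => x ln := (EuclideanSpace.proj ln : Eu n →L[ℝ] ℝ).contDiff
  fun_prop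

lemma eq_toHeightOne_add (hψc : ContinuousOn ψ {x : Eu n | 0 ≤ x ln})
    (hψ : ∀ x : Eu n, 0 < x ln → DifferentiableAt ℝ ψ x)
    (ha : ∀ x : Eu n, 0 < x ln → pd ψ ln x = a * x ln) {x : Eu n} (hx : 0 ≤ x ln) :
    ψ x = ψ (toHeightOne ln x) + a / 2 * (x ln ^ 2 - 1) := by
  set e : Eu n := EuclideanSpace.single ln (1 : ℝ) with he
  set x' : Eu n := x - x ln • e with hx'
  have hcoord : ∀ s : ℝ, (x' + s • e) ln = s := fun s => by simp [hx', he]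
  set φ : ℝ → ℝ := fun s => ψ (x' + s • e) - a / 2 * s ^ 2 with hφ
  have hc : ContinuousOn φ (Ici 0) := by
    refine ContinuousOn.sub (hψc.comp (t := {x : Eu n | 0 ≤ x ln})
      (f := fun s : ℝ => x' + s • e) (by fun_prop) fun s hs => ?_) (by fun_prop)
    rw [mem_ofPred_eq, hcoord]
    exact hs
  have hd : ∀ s : ℝ, 0 < s → HasDerivAt φ 0 s := fun s hs => by
    have h1 : HasDerivAt (fun s : ℝ => ψ (x' + s • e)) (pd ψ ln (x' + s • e)) s :=
      (hψ _ (by rwa [hcoord])).hasFDerivAt.comp_hasDerivAt s (hasDerivAt_line x' e s)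
    rw [ha _ (by rwa [hcoord]), hcoord] at h1
    refine (h1.fun_sub ((hasDerivAt_pow 2 s).const_mul (a / 2))).congr_deriv ?_
    norm_num
    ring
  have hconst : ∀ s t : ℝ, 0 ≤ s → s < t → φ s = φ t := fun s t hs hst => by
    obtain ⟨ξ, -, hξ⟩ := exists_hasDerivAt_eq_slope φ (fun _ => 0) hst
      (hc.mono fun r hr => hs.trans hr.1) fun r hr => hd r (hs.trans_lt hr.1)
    have : 0 < t - s := sub_pos.2 hst
    field_simp at hξ
    linarith
  have h1 : φ (x ln) = φ 1 := by
    rcases lt_trichotomy (x ln) 1 with h | h | h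
    · exact hconst _ _ hx h
    · rw [h]
    · exact (hconst _ _ zero_le_one h).symm
  have h2 : x' + x ln • e = x := by simp [hx']
  have h3 : x' + (1 : ℝ) • e = toHeightOne ln x := by rw [toHeightOne, ← he, hx']; module
  simp only [hφ, h2, h3] at h1
  linarith

lemma hessQuad_extendFromHeightOne (hψ : ∀ x : Eu n, 0 < x ln → ContDiffAt ℝ 2 ψ x)
    (ha : ∀ x : Eu n, 0 < x ln → pd ψ ln x = a * x ln)
    (hred : ∀ x : Eu n, 0 < x ln → ψ x = ψ (toHeightOne ln x) + a / 2 * (x ln ^ 2 - 1))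
    (hu : ContDiff ℝ 2 (extendFromHeightOne ψ ln (a / 2 * (1 + b)))) (x z : Eu n) :
    hessQuad (extendFromHeightOne ψ ln (a / 2 * (1 + b))) x z =
      bHess b ψ ln (toHeightOne ln x) z := by
  set y := toHeightOne ln x with hy
  have hy1 : y ln = 1 := toHeightOne_apply x
  refine tendsto_nhds_unique (tendsto_secondDiff hu.contDiffAt z) ?_
  have hlim := (tendsto_secondDiff (hψ y (by rw [hy1]; exact one_pos)) z).add_const
    (a * b * z ln ^ 2)
  rw [bHess, ha y (by rw [hy1]; exact one_pos), hy1, mul_one, div_one, mul_comm b a]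
  refine hlim.congr' ?_
  have hpos : ∀ w : Eu n, ∀ᶠ s : ℝ in 𝓝[>] 0, 0 < (y + s • w) ln := fun w => by
    have hc : Continuous fun s : ℝ => (y + s • w) ln := by fun_prop
    have := (hc.tendsto 0).eventually (lt_mem_nhds (a := 0) (by simp [hy1]))
    exact nhdsWithin_le_nhds this
  filter_upwards [hpos z, hpos (-z), self_mem_nhdsWithin] with s h1 h2 hs
  have hs0 : (0 : ℝ) < s := hs
  rw [smul_neg, ← sub_eq_add_neg] at h2
  have h3 : toHeightOne ln (y - s • z) = toHeightOne ln (x - s • z) := by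
    rw [sub_eq_add_neg, sub_eq_add_neg, hy, toHeightOne_toHeightOne_add]
  have h4 : toHeightOne ln y = y := by
    have := toHeightOne_toHeightOne_add (ln := ln) x 0
    rwa [add_zero, add_zero, ← hy] at this
  simp only [secondDiff, extendFromHeightOne]
  rw [hred _ h1, hred _ h2, h3, hy, toHeightOne_toHeightOne_add, ← hy]
  simp only [PiLp.add_apply, PiLp.sub_apply, PiLp.smul_apply, smul_eq_mul, hy1]
  field_simp
  ring

lemma eq_quadratic_of_hessQuad_const {E : Type*} [NormedAddCommGroup E] [NormedSpace ℝ E]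
    {u : E → ℝ} (hu : ContDiff ℝ 2 u) (hc : ∀ x y z, hessQuad u x z = hessQuad u y z) (x : E) :
    u x = u 0 + fderiv ℝ u 0 x + hessQuad u 0 x / 2 := by
  have h1 : ∀ s : ℝ, HasDerivAt (fun s : ℝ => u (0 + s • x)) (fderiv ℝ u (0 + s • x) x) s :=
    fun s => (hu.differentiable (by simp) _).hasFDerivAt.comp_hasDerivAt s (hasDerivAt_line 0 x s)
  have h2 : ∀ s : ℝ, HasDerivAt (fun s : ℝ => fderiv ℝ u (0 + s • x) x) (hessQuad u 0 x) s :=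
    fun s => by
      rw [hc 0 (0 + s • x)]
      exact hasDerivAt_fderiv_comp_line hu.contDiffAt
  have h3 : ∀ s : ℝ, fderiv ℝ u (0 + s • x) x = fderiv ℝ u 0 x + hessQuad u 0 x * s := fun s => by
    have hd : ∀ s : ℝ, HasDerivAt
        (fun s : ℝ => fderiv ℝ u (0 + s • x) x - hessQuad u 0 x * s) 0 s := fun s => by
      simpa using (h2 s).fun_sub ((hasDerivAt_id s).const_mul (hessQuad u 0 x))
    have := is_const_of_deriv_eq_zero (fun s => (hd s).differentiableAt)
      (fun s => (hd s).deriv) s 0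
    simp only [zero_smul, add_zero, mul_zero, sub_zero] at this
    linarith
  have hd : ∀ s : ℝ, HasDerivAt
      (fun s : ℝ => u (0 + s • x) - (fderiv ℝ u 0 x * s + hessQuad u 0 x / 2 * s ^ 2)) 0 s :=
    fun s => by
      refine ((h1 s).fun_sub (((hasDerivAt_id s).const_mul (fderiv ℝ u 0 x)).fun_add
        ((hasDerivAt_pow 2 s).const_mul (hessQuad u 0 x / 2)))).congr_deriv ?_
      rw [h3]
      norm_num
      ring
  have := is_const_of_deriv_eq_zero (fun s => (hd s).differentiableAt)
    (fun s => (hd s).deriv) 1 0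
  simp only [zero_smul, add_zero, zero_add, one_smul, mul_zero, sub_zero, mul_one, one_pow, ne_eq,
    OfNat.ofNat_ne_zero, not_false_eq_true, zero_pow] at this
  linarith

end Reduction

section Conclusion

open Filter Topology Set Metric

variable {n : ℕ} {ψ : Eu n → ℝ} {ln : Fin n} {b C : ℝ}

lemma sum_smul_tangential (x : Eu n) :
    ∑ i, x i • (if i = ln then 0 else EuclideanSpace.single i (1 : ℝ)) =
      x - x ln • EuclideanSpace.single ln (1 : ℝ) := by
  have h : ∀ i, x i • (if i = ln then 0 else EuclideanSpace.single i (1 : ℝ)) =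
      x i • (EuclideanSpace.single i (1 : ℝ) : Eu n) -
        if i = ln then x i • EuclideanSpace.single i (1 : ℝ) else 0 := fun i => by
    split_ifs <;> simp
  rw [Finset.sum_congr rfl fun i _ => h i, Finset.sum_sub_distrib, sum_smul_single,
    Finset.sum_ite_eq' Finset.univ ln, if_pos (Finset.mem_univ ln)]

/-- The conclusion for the half-space once `∂ψ/∂xₙ` is known to be proportional to `xₙ`. -/
lemma exists_quadratic_of_pd_eq [NeZero n] {a : ℝ} (hb : 0 ≤ b) (hC : 0 < C)
    (hψc : ContinuousOn ψ {x : Eu n | 0 ≤ x ln})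
    (hψ : ∀ x : Eu n, 0 < x ln → ContDiffAt ℝ 2 ψ x)
    (heq : ∀ x : Eu n, 0 < x ln → (Mb b ψ ln x).det = 1)
    (hell : ∀ x : Eu n, 0 < x ln →
      matLE (C⁻¹ • (1 : Matrix (Fin n) (Fin n) ℝ)) (Mb b ψ ln x) ∧
      matLE (Mb b ψ ln x) (C • (1 : Matrix (Fin n) (Fin n) ℝ)))
    (ha : ∀ x : Eu n, 0 < x ln → pd ψ ln x = a * x ln) :
    0 < a ∧ ∃ (c : ℝ) (l : Fin n → ℝ) (Q : Matrix (Fin n) (Fin n) ℝ),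
      l ln = 0 ∧ (∀ i : Fin n, Q i ln = 0 ∧ Q ln i = 0) ∧
      ∀ x : Eu n, 0 ≤ x ln →
        ψ x = c + (∑ i, l i * x i) + (∑ i, ∑ j, Q i j * x i * x j) + a / 2 * (x ln) ^ 2 := by
  have hred := fun x hx => eq_toHeightOne_add (x := x) hψc
    (fun x hx => (hψ x hx).differentiableAt (by simp)) ha hx
  have hone : ∀ x : Eu n, 0 < toHeightOne ln x ln := fun x => by simp
  have hu : ContDiff ℝ 2 (extendFromHeightOne ψ ln (a / 2 * (1 + b))) := by
    refine ContDiff.add (contDiff_iff_contDiffAt.2 fun x => ?_)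
      (contDiff_const.mul
        ((EuclideanSpace.proj ln : Eu n →L[ℝ] ℝ).contDiff.pow 2))
    exact ContDiffAt.comp (g := ψ) (f := toHeightOne ln) x (hψ _ (hone x))
      contDiff_toHeightOne.contDiffAt
  set u := extendFromHeightOne ψ ln (a / 2 * (1 + b)) with hud
  have hhess : ∀ x z, hessQuad u x z = bHess b ψ ln (toHeightOne ln x) z :=
    hessQuad_extendFromHeightOne hψ ha (fun x hx => hred x hx.le) hu
  have hbounds := fun x z =>
    bHess_bounds (hψ _ (hone x)) (hell _ (hone x)).1 (hell _ (hone x)).2 z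
  have hcontrol : HessianControl u C⁻¹ C (C ^ 2 * (1 + √(n * C ^ 2)) ^ 2) :=
    { contDiff := hu
      nonneg := fun x v => by
        rw [hhess]
        exact le_trans (by positivity) (hbounds x v).1
      le := fun x v => by
        rw [hhess]
        exact (hbounds x v).2
      frame := fun x => by
        obtain ⟨V, hV1, hV2, hV3⟩ := exists_bHess_frame hψ heq hC hell _ (hone x)
        refine ⟨V, hV1, hV2, fun y z => ?_⟩
        simp only [hhess]
        exact hV3 _ (hone y) z }
  have hquad := eq_quadratic_of_hessQuad_const hu
    (hcontrol.hessQuad_const (inv_pos.2 hC) hC (by positivity))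
  set e : Eu n := EuclideanSpace.single ln (1 : ℝ) with he
  have ha0 : 0 < a := by
    have h1 := (hbounds 0 e).1
    rw [← hhess] at h1
    have h2 : hessQuad u 0 e = a * (1 + b) := by
      refine tendsto_nhds_unique (tendsto_secondDiff hu.contDiffAt e) (tendsto_const_nhds.congr' ?_)
      filter_upwards [self_mem_nhdsWithin] with s hs
      have hs0 : (0 : ℝ) < s := hs
      have h3 : ∀ s : ℝ, toHeightOne ln (s • e) = toHeightOne ln 0 := fun s => by
        simp only [toHeightOne, he, PiLp.smul_apply, PiLp.single_apply, if_true,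
          smul_eq_mul, mul_one, PiLp.zero_apply]
        module
      rw [secondDiff, zero_add, zero_sub, ← neg_smul, hud]
      simp only [extendFromHeightOne, h3]
      simp [he]
      field_simp
      ring
    rw [h2] at h1
    have h3 : 0 < a * (1 + b) := by
      refine lt_of_lt_of_le ?_ h1
      simp only [he, PiLp.norm_single, norm_one, one_pow, mul_one]
      exact inv_pos.2 hC
    exact pos_of_mul_pos_left h3 (by linarith)
  refine ⟨ha0, ?_⟩
  set f : Fin n → Eu n := fun i => if i = ln then 0 else EuclideanSpace.single i (1 : ℝ) with hf
  have hfln : f ln = 0 := by simp [hf]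
  refine ⟨u 0 - a / 2, fun i => fderiv ℝ u 0 (f i),
    Matrix.of fun i j => fderiv ℝ (fderiv ℝ u) 0 (f i) (f j) / 2, by simp [hfln],
    fun i => by simp [hfln], fun x hx => ?_⟩
  set x' : Eu n := x - x ln • e with hx'
  have hsum : x' = ∑ i, x i • f i := (sum_smul_tangential x).symm
  have hx'ln : x' ln = 0 := by simp [hx', he]
  have h1 : toHeightOne ln x' = toHeightOne ln x := by
    rw [toHeightOne, hx'ln, toHeightOne, hx', ← he]
    module
  have h2 : u x' = ψ (toHeightOne ln x) := by
    rw [hud, extendFromHeightOne, h1, hx'ln]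
    ring
  have h3 : ∑ i, fderiv ℝ u 0 (f i) * x i = fderiv ℝ u 0 x' := by
    rw [hsum, map_sum]
    exact Finset.sum_congr rfl fun i _ => by rw [map_smul, smul_eq_mul, mul_comm]
  have h4 : ∑ i, ∑ j, fderiv ℝ (fderiv ℝ u) 0 (f i) (f j) / 2 * x i * x j =
      hessQuad u 0 x' / 2 := by
    rw [hessQuad, hsum]
    simp only [map_sum, map_smul, _root_.sum_apply, _root_.smul_apply, smul_eq_mul,
      Finset.mul_sum, Finset.sum_div]
    rw [Finset.sum_comm]
    exact Finset.sum_congr rfl fun i _ => Finset.sum_congr rfl fun j _ => by ring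
  simp only [Matrix.of_apply]
  rw [h3, h4, hred x hx, ← h2, hquad x']
  ring

lemma halfSpaceControl (hC : 0 < C) {L : NNReal} {Dψ : Eu n → (Eu n →L[ℝ] ℝ)}
    (hC1 : ∀ x : Eu n, 0 ≤ x ln →
      HasFDerivWithinAt ψ (Dψ x) {y : Eu n | 0 ≤ y ln} x)
    (hLip : LipschitzOnWith L Dψ {y : Eu n | 0 ≤ y ln})
    (hψ : ∀ x : Eu n, 0 < x ln → ContDiffAt ℝ 2 ψ x)
    (heq : ∀ x : Eu n, 0 < x ln → (Mb b ψ ln x).det = 1)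
    (hell : ∀ x : Eu n, 0 < x ln →
      matLE (C⁻¹ • (1 : Matrix (Fin n) (Fin n) ℝ)) (Mb b ψ ln x) ∧
      matLE (Mb b ψ ln x) (C • (1 : Matrix (Fin n) (Fin n) ℝ)))
    (hbdry : ∀ x : Eu n, x ln = 0 → Dψ x (EuclideanSpace.single ln 1) = 0) :
    HalfSpaceControl ψ ln b C⁻¹ C L := by
  set e : Eu n := EuclideanSpace.single ln (1 : ℝ) with he
  have he1 : ‖e‖ = 1 := by simp [he]
  have hpd : ∀ x : Eu n, 0 < x ln → pd ψ ln x = Dψ x e := fun x hx => by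
    have hc : Continuous fun y : Eu n => y ln := by fun_prop
    have hmem : {y : Eu n | 0 ≤ y ln} ∈ 𝓝 x :=
      mem_of_superset ((isOpen_lt continuous_const hc).mem_nhds hx) fun y (hy : 0 < y ln) => hy.le
    rw [pd, ((hC1 x hx.le).hasFDerivAt hmem).fderiv]
  have hD : ∀ x y : Eu n, 0 ≤ x ln → 0 ≤ y ln → |Dψ x e - Dψ y e| ≤ L * ‖x - y‖ :=
    fun x y hx hy => by
      have h1 := (Dψ x - Dψ y).le_opNorm e
      rw [he1, mul_one, ← dist_eq_norm] at h1
      have h2 := hLip.dist_le_mul x hx y hy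
      rw [← dist_eq_norm]
      exact h1.trans h2
  refine ⟨hψ, fun x hx => ?_, fun x y hx hy => ?_, fun x hx => ?_⟩
  · have hln : (x - x ln • e) ln = 0 := by simp [he]
    have := hD x (x - x ln • e) hx.le hln.ge
    rwa [hbdry _ hln, sub_zero, sub_sub_cancel, norm_smul, he1, mul_one,
      Real.norm_of_nonneg hx.le, ← hpd x hx] at this
  · rw [hpd x hx, hpd y hy]
    exact hD x y hx.le hy.le
  · obtain ⟨V, hV1, hV2, hV3⟩ := exists_bHess_frame hψ heq hC hell x hx
    refine ⟨V, hV1, hV2, fun y hy => ?_⟩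
    have := (sq_nonneg _).trans (hV3 y hy e)
    rw [he1, one_pow, mul_one] at this
    exact nonneg_of_mul_nonneg_right this (by positivity)

end Conclusion

theorem stmt0 (n : ℕ) (hn : 2 ≤ n) (ln : Fin n) (hln : (ln : ℕ) = n - 1)
    (b : ℝ) (hb : b = ((n : ℝ) + 2) / n)
    (ψ : Eu n → ℝ) (Dψ : Eu n → (Eu n →L[ℝ] ℝ)) (L : NNReal)
    -- ψ is C¹ on the closed half-space with gradient Dψ …
    (hC1 : ∀ x : Eu n, 0 ≤ x ln →
      HasFDerivWithinAt ψ (Dψ x) {y : Eu n | 0 ≤ y ln} x)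
    -- … and the gradient is Lipschitz there
    (hLip : LipschitzOnWith L Dψ {y : Eu n | 0 ≤ y ln})
    -- ψ is C² in the open half-space
    (hC2 : ContDiffOn ℝ 2 ψ {y : Eu n | 0 < y ln})
    -- det M_b[ψ] = 1 in the open half-space
    (heq : ∀ x : Eu n, 0 < x ln → (Mb b ψ ln x).det = 1)
    -- uniform ellipticity
    (Chat : ℝ) (hChat : 0 < Chat)
    (hell : ∀ x : Eu n, 0 < x ln →
      matLE (Chat⁻¹ • (1 : Matrix (Fin n) (Fin n) ℝ)) (Mb b ψ ln x) ∧
      matLE (Mb b ψ ln x) (Chat • (1 : Matrix (Fin n) (Fin n) ℝ)))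
    -- Neumann boundary condition ψ_{x_n}(x',0) = 0
    (hbdry : ∀ x : Eu n, x ln = 0 → Dψ x (EuclideanSpace.single ln 1) = 0) :
    ∃ a : ℝ, 0 < a ∧ ∃ (c : ℝ) (l : Fin n → ℝ) (Q : Matrix (Fin n) (Fin n) ℝ),
      l ln = 0 ∧ (∀ i : Fin n, Q i ln = 0 ∧ Q ln i = 0) ∧
      ∀ x : Eu n, 0 ≤ x ln →
        ψ x = c + (∑ i, l i * x i) + (∑ i, ∑ j, Q i j * x i * x j)
          + a * (x ln) ^ 2 := by
  have : NeZero n := ⟨by omega⟩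
  have hb0 : 0 ≤ b := by rw [hb]; positivity
  have hψ : ∀ x : Eu n, 0 < x ln → ContDiffAt ℝ 2 ψ x := fun x hx =>
    hC2.contDiffAt ((isOpen_lt continuous_const
      (by fun_prop : Continuous fun y : Eu n => y ln)).mem_nhds hx)
  have hCC : Chat⁻¹ ≤ Chat := by
    have he : 0 < (EuclideanSpace.single ln (1 : ℝ) : Eu n) ln := by simp
    have h := bHess_bounds (hψ _ he) (hell _ he).1 (hell _ he).2 (EuclideanSpace.single ln (1 : ℝ))
    simpa using h.1.trans h.2
  obtain ⟨a, ha⟩ := (halfSpaceControl hChat hC1 hLip hψ heq hell hbdry).exists_pd_eq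
    (inv_pos.2 hChat) hCC hb0 L.2
  obtain ⟨ha0, h⟩ := exists_quadratic_of_pd_eq hb0 hChat
    (fun x hx => (hC1 x hx).continuousWithinAt) hψ heq hell ha
  exact ⟨a / 2, by positivity, h⟩
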